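/- arXiv:1207.5126 — 2 statements merged into one kernel-verified Lean document; each statement's English description precedes it below -/
import Mathlib

section
/- Let W : ℝ → (0,∞) be a continuous weight with lim_{|x|→∞} x^n/W(x) = 0 for every n ∈ ℕ, and let 𝔪(z) := sup{|P(z)| : P a polynomial with complex coefficients, ‖P‖_{C₀(W)} ≤ 1} be the Hall majorant (with value ∞ if the supremum is unbounded). Then the following are equivalent: (i) the polynomials ℂ[z] are dense in C₀(W); (ii) 𝔪(z₀) = ∞ for some non-real z₀ ∈ ℂ; (iii) 𝔪(z) = ∞ for all non-real z ∈ ℂ. -/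
open Filter Polynomial
open scoped ENNReal NNReal

/-- Membership in the weighted space `C₀(W)` for a finite positive weight `W` on `ℝ`:
continuous functions `f : ℝ → ℂ` with `|f(x)|/W(x) → 0` as `|x| → ∞`. -/
def MemC0 (W : ℝ → ℝ) (f : ℝ → ℂ) : Prop :=
  Continuous f ∧ Tendsto (fun x => ‖f x‖ / W x) (cocompact ℝ) (nhds 0)

/-- Density of the polynomials in `C₀(W)` with respect to the seminorm
`‖f‖ = sup_x |f(x)|/W(x)` (note that, since `W > 0`, `‖f‖ ≤ ε` is equivalent to
`∀ x, |f(x)| ≤ ε·W(x)`). -/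
def PolysDense (W : ℝ → ℝ) : Prop :=
  ∀ f : ℝ → ℂ, MemC0 W f → ∀ ε : ℝ, 0 < ε →
    ∃ P : Polynomial ℂ, ∀ x : ℝ, ‖f x - P.eval (x : ℂ)‖ ≤ ε * W x

/-- The Hall majorant `𝔪(z) = sup {|P(z)| : ‖P‖_{C₀(W)} ≤ 1}`, with value `∞` when
the supremum is unbounded.  (Since `W > 0` is real-valued, `‖P‖_{C₀(W)} ≤ 1` is
equivalent to `∀ x, |P(x)| ≤ W(x)`.) -/
noncomputable def hallMajorant (W : ℝ → ℝ) (z : ℂ) : ℝ≥0∞ :=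
  ⨆ P : {P : Polynomial ℂ // ∀ x : ℝ, ‖P.eval (x : ℂ)‖ ≤ W x},
    (‖(P : Polynomial ℂ).eval z‖₊ : ℝ≥0∞)


/-- A linear functional on complex-valued functions which, on bounded functions, is continuous
for the supremum norm and the complexification of a positive real functional. -/
structure IsBoundedPositive {X : Type*} (ℓ : (X → ℂ) →ₗ[ℂ] ℂ) (L : ℝ) : Prop where
  nonneg : 0 ≤ L
  norm_le : ∀ (F : X → ℂ) (c : ℝ), (∀ x, ‖F x‖ ≤ c) → ‖ℓ F‖ ≤ c * L
  im_nonneg : ∀ (F : X → ℂ) (c : ℝ), (∀ x, ‖F x‖ ≤ c) → (∀ x, 0 ≤ (F x).im) → 0 ≤ (ℓ F).im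

/-- The Cauchy transform of the density `k` with respect to the functional `ℓ`. -/
noncomputable def cauchyTransform {X : Type*} (ℓ : (X → ℂ) →ₗ[ℂ] ℂ) (u : X → ℝ) (k : X → ℂ)
    (z : ℂ) : ℂ :=
  ℓ fun x => k x / ((u x : ℂ) - z)

lemma im_le_norm_ofReal_sub (x : ℝ) (z : ℂ) : |z.im| ≤ ‖(x : ℂ) - z‖ := by
  simpa using Complex.abs_im_le_norm ((x : ℂ) - z)

lemma ofReal_sub_ne_zero (x : ℝ) {z : ℂ} (hz : z.im ≠ 0) : (x : ℂ) - z ≠ 0 := by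
  intro h
  have := im_le_norm_ofReal_sub x z
  rw [h, norm_zero] at this
  exact hz (abs_nonpos_iff.1 this)

lemma norm_div_ofReal_sub_le {a z : ℂ} {c : ℝ} (x : ℝ) (hz : 0 < z.im) (ha : ‖a‖ ≤ c) :
    ‖a / ((x : ℂ) - z)‖ ≤ c / z.im := by
  have h := im_le_norm_ofReal_sub x z
  rw [abs_of_pos hz] at h
  rw [norm_div]
  exact div_le_div₀ ((norm_nonneg _).trans ha) ha hz h

section CauchyTransform

variable {X : Type*} {ℓ : (X → ℂ) →ₗ[ℂ] ℂ} {L : ℝ} (u : X → ℝ)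

lemma cauchyTransform_differentiableAt (hℓ : IsBoundedPositive ℓ L) {k : X → ℂ} {c : ℝ}
    (hk : ∀ x, ‖k x‖ ≤ c) {z : ℂ} (hz : 0 < z.im) :
    DifferentiableAt ℂ (cauchyTransform ℓ u k) z := by
  have hder : HasDerivAt (cauchyTransform ℓ u k)
      (ℓ fun x => k x / ((u x : ℂ) - z) / ((u x : ℂ) - z)) z := by
    rw [hasDerivAt_iff_isLittleO]
    have hO : (fun w : ℂ => cauchyTransform ℓ u k w - cauchyTransform ℓ u k z -
        (w - z) • ℓ fun x => k x / ((u x : ℂ) - z) / ((u x : ℂ) - z))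
        =O[nhds z] fun w => (w - z) ^ 2 := by
      refine Asymptotics.IsBigO.of_bound (c / z.im / z.im / (z.im / 2) * L) ?_
      have hev : ∀ᶠ w : ℂ in nhds z, z.im / 2 < w.im :=
        Complex.continuous_im.continuousAt.eventually_const_lt (half_lt_self hz)
      filter_upwards [hev] with w hw
      have hw0 : 0 < w.im := (half_pos hz).trans hw
      have key : cauchyTransform ℓ u k w - cauchyTransform ℓ u k z -
          (w - z) • ℓ (fun x => k x / ((u x : ℂ) - z) / ((u x : ℂ) - z)) =
          (w - z) ^ 2 • ℓ fun x => k x / ((u x : ℂ) - z) / ((u x : ℂ) - z) / ((u x : ℂ) - w) := by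
        rw [cauchyTransform, cauchyTransform, ← map_smul, ← map_smul, ← map_sub, ← map_sub]
        congr 1
        funext x
        have h1 := ofReal_sub_ne_zero (u x) hz.ne'
        have h2 := ofReal_sub_ne_zero (u x) hw0.ne'
        simp only [Pi.sub_apply, Pi.smul_apply, smul_eq_mul]
        field_simp
        ring
      rw [key, norm_smul, mul_comm]
      refine mul_le_mul_of_nonneg_right (hℓ.norm_le _ _ fun x => ?_) (norm_nonneg _)
      have h1 := norm_div_ofReal_sub_le (u x) hz
        (norm_div_ofReal_sub_le (u x) hz (hk x))
      refine (norm_div_ofReal_sub_le (u x) hw0 h1).trans ?_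
      have : 0 ≤ c := (norm_nonneg _).trans (hk x)
      gcongr
    refine hO.trans_isLittleO ?_
    have := (Asymptotics.isLittleO_pow_sub_sub (E' := ℂ) z (show 1 < 2 by norm_num))
    refine Asymptotics.IsLittleO.of_norm_left ?_
    simpa only [norm_pow] using this
  exact hder.differentiableAt

lemma norm_cauchyTransform_le (hℓ : IsBoundedPositive ℓ L) {k : X → ℂ} {c : ℝ}
    (hk : ∀ x, ‖k x‖ ≤ c) {z : ℂ} (hz : 0 < z.im) :
    ‖cauchyTransform ℓ u k z‖ ≤ c / z.im * L :=
  hℓ.norm_le _ _ fun x => norm_div_ofReal_sub_le (u x) hz (hk x)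

/-- The Cauchy transform of a positive density takes values in the upper half-plane, so it is
made bounded by a bounded holomorphic factor that can be controlled from below. -/
lemma exists_bounding_factor_of_nonneg (hℓ : IsBoundedPositive ℓ L) {k : X → ℝ}
    (hk0 : ∀ x, 0 ≤ k x) (hk1 : ∀ x, k x ≤ 1) :
    ∃ D : ℂ → ℂ, ∀ z : ℂ, 0 < z.im → DifferentiableAt ℂ D z ∧ ‖D z‖ ≤ 1 ∧
      ‖cauchyTransform ℓ u (fun x => (k x : ℂ)) z * D z‖ ≤ 2 ∧ 1 ≤ (1 + L / z.im) * ‖D z‖ := by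
  set G := cauchyTransform ℓ u (fun x => (k x : ℂ)) with hG
  have hk : ∀ x, ‖(k x : ℂ)‖ ≤ 1 := fun x => by
    rw [Complex.norm_real, Real.norm_of_nonneg (hk0 x)]; exact hk1 x
  refine ⟨fun z => (G z + Complex.I)⁻¹, fun z hz => ?_⟩
  have him : 0 ≤ (G z).im := by
    refine hℓ.im_nonneg _ (1 / z.im) (fun x => norm_div_ofReal_sub_le (u x) hz (hk x)) fun x => ?_
    rw [Complex.div_im]
    simp only [Complex.ofReal_re, Complex.ofReal_im, Complex.sub_im, Complex.sub_re]
    have := Complex.normSq_nonneg ((u x : ℂ) - z)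
    have h2 := mul_nonneg (hk0 x) hz.le
    have : k x * (0 - z.im) / Complex.normSq ((u x : ℂ) - z) ≤ 0 :=
      div_nonpos_of_nonpos_of_nonneg (by linarith) this
    simp only [zero_mul, zero_div]
    linarith
  have h1 : 1 ≤ ‖G z + Complex.I‖ := by
    have := Complex.abs_im_le_norm (G z + Complex.I)
    rw [Complex.add_im, Complex.I_im, abs_of_nonneg (by linarith)] at this
    linarith
  have hne : G z + Complex.I ≠ 0 := by
    intro h; rw [h, norm_zero] at h1; linarith
  have hD : ‖(G z + Complex.I)⁻¹‖ ≤ 1 := by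
    rw [norm_inv]; exact inv_le_one_of_one_le₀ h1
  refine ⟨?_, hD, ?_, ?_⟩
  · exact ((cauchyTransform_differentiableAt u hℓ hk hz).add_const _).inv hne
  · have : G z * (G z + Complex.I)⁻¹ = 1 - Complex.I * (G z + Complex.I)⁻¹ := by
      field_simp; ring
    rw [this]
    refine (norm_sub_le _ _).trans ?_
    rw [norm_mul, Complex.norm_I, norm_one]
    linarith
  · have h2 : ‖G z + Complex.I‖ ≤ 1 + L / z.im := by
      have := norm_cauchyTransform_le u hℓ hk hz
      refine (norm_add_le _ _).trans ?_
      rw [Complex.norm_I]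
      have : 1 / z.im * L = L / z.im := by ring
      linarith
    rw [norm_inv, ← div_eq_mul_inv, le_div_iff₀ (by linarith)]
    linarith

lemma cauchyTransform_add (k₁ k₂ : X → ℂ) (z : ℂ) :
    cauchyTransform ℓ u (fun x => k₁ x + k₂ x) z =
      cauchyTransform ℓ u k₁ z + cauchyTransform ℓ u k₂ z := by
  rw [cauchyTransform, cauchyTransform, cauchyTransform, ← map_add]
  congr 1
  funext x
  simp only [Pi.add_apply, add_div]

lemma cauchyTransform_const_mul (a : ℂ) (k : X → ℂ) (z : ℂ) :
    cauchyTransform ℓ u (fun x => a * k x) z = a * cauchyTransform ℓ u k z := by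
  rw [cauchyTransform, cauchyTransform, ← smul_eq_mul a, ← map_smul]
  congr 1
  funext x
  simp only [Pi.smul_apply, smul_eq_mul, mul_div_assoc]

lemma exists_bounding_factor (hℓ : IsBoundedPositive ℓ L) {k : X → ℂ} {c : ℝ} (hc : 0 < c)
    (hk : ∀ x, ‖k x‖ ≤ c) :
    ∃ D : ℂ → ℂ, ∀ z : ℂ, 0 < z.im → DifferentiableAt ℂ D z ∧ ‖D z‖ ≤ 1 ∧
      ‖cauchyTransform ℓ u k z * D z‖ ≤ 8 * c ∧ 1 ≤ (1 + L / z.im) ^ 4 * ‖D z‖ := by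
  have hpart : ∀ t : ℝ, |t| ≤ c → max t 0 / c ≤ 1 ∧ max (-t) 0 / c ≤ 1 := by
    intro t ht
    rw [div_le_one hc, div_le_one hc]
    have := abs_le.1 ht
    exact ⟨max_le this.2 hc.le, max_le (by linarith) hc.le⟩
  have hre : ∀ x, |(k x).re| ≤ c := fun x => (Complex.abs_re_le_norm _).trans (hk x)
  have him : ∀ x, |(k x).im| ≤ c := fun x => (Complex.abs_im_le_norm _).trans (hk x)
  obtain ⟨D₀, h₀⟩ := exists_bounding_factor_of_nonneg u hℓ
    (k := fun x => max (k x).re 0 / c) (fun x => by positivity) fun x => (hpart _ (hre x)).1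
  obtain ⟨D₁, h₁⟩ := exists_bounding_factor_of_nonneg u hℓ
    (k := fun x => max (-(k x).re) 0 / c) (fun x => by positivity) fun x => (hpart _ (hre x)).2
  obtain ⟨D₂, h₂⟩ := exists_bounding_factor_of_nonneg u hℓ
    (k := fun x => max (k x).im 0 / c) (fun x => by positivity) fun x => (hpart _ (him x)).1
  obtain ⟨D₃, h₃⟩ := exists_bounding_factor_of_nonneg u hℓ
    (k := fun x => max (-(k x).im) 0 / c) (fun x => by positivity) fun x => (hpart _ (him x)).2
  refine ⟨fun z => D₀ z * D₁ z * D₂ z * D₃ z, fun z hz => ?_⟩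
  obtain ⟨d₀, n₀, b₀, l₀⟩ := h₀ z hz
  obtain ⟨d₁, n₁, b₁, l₁⟩ := h₁ z hz
  obtain ⟨d₂, n₂, b₂, l₂⟩ := h₂ z hz
  obtain ⟨d₃, n₃, b₃, l₃⟩ := h₃ z hz
  refine ⟨((d₀.mul d₁).mul d₂).mul d₃, ?_, ?_, ?_⟩
  · simp only [norm_mul]
    exact mul_le_one₀ (mul_le_one₀ (mul_le_one₀ n₀ (norm_nonneg _) n₁) (norm_nonneg _) n₂)
      (norm_nonneg _) n₃
  · have hsplit : k = fun x => (c : ℂ) * ((max (k x).re 0 / c : ℝ) : ℂ) +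
        ((-c : ℂ) * ((max (-(k x).re) 0 / c : ℝ) : ℂ) +
        ((c * Complex.I : ℂ) * ((max (k x).im 0 / c : ℝ) : ℂ) +
        (-c * Complex.I : ℂ) * ((max (-(k x).im) 0 / c : ℝ) : ℂ))) := by
      funext x
      have hmax : ∀ t : ℝ, max t 0 - max (-t) 0 = t := fun t => by
        rcases le_total t 0 with h | h
        · rw [max_eq_right h, max_eq_left (by linarith)]; ring
        · rw [max_eq_left h, max_eq_right (by linarith)]; ring
      have hc' : (c : ℂ) ≠ 0 := by exact_mod_cast hc.ne'
      conv_lhs => rw [← Complex.re_add_im (k x), ← hmax (k x).re, ← hmax (k x).im]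
      push_cast
      field_simp
      ring
    rw [hsplit]
    simp only [cauchyTransform_add, cauchyTransform_const_mul]
    set G₀ := cauchyTransform ℓ u (fun x => ((max (k x).re 0 / c : ℝ) : ℂ)) z
    set G₁ := cauchyTransform ℓ u (fun x => ((max (-(k x).re) 0 / c : ℝ) : ℂ)) z
    set G₂ := cauchyTransform ℓ u (fun x => ((max (k x).im 0 / c : ℝ) : ℂ)) z
    set G₃ := cauchyTransform ℓ u (fun x => ((max (-(k x).im) 0 / c : ℝ) : ℂ)) z
    have hfour : ∀ a x y v w : ℂ, ‖a‖ = c → ‖x‖ ≤ 2 → ‖y‖ ≤ 1 → ‖v‖ ≤ 1 → ‖w‖ ≤ 1 →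
        ‖a * x * (y * v * w)‖ ≤ 2 * c := by
      intro a x y v w ha hx hy hv hw
      have : ‖y * v * w‖ ≤ 1 := by
        simp only [norm_mul]
        exact mul_le_one₀ (mul_le_one₀ hy (norm_nonneg _) hv) (norm_nonneg _) hw
      rw [norm_mul, norm_mul, ha]
      nlinarith [norm_nonneg x, norm_nonneg (y * v * w), mul_le_mul hx this (norm_nonneg _)
        zero_le_two]
    have e : (c * G₀ + (-c * G₁ + (c * Complex.I * G₂ + -c * Complex.I * G₃))) *
        (D₀ z * D₁ z * D₂ z * D₃ z) =
        c * (G₀ * D₀ z) * (D₁ z * D₂ z * D₃ z) + -c * (G₁ * D₁ z) * (D₀ z * D₂ z * D₃ z) +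
        c * Complex.I * (G₂ * D₂ z) * (D₀ z * D₁ z * D₃ z) +
        -c * Complex.I * (G₃ * D₃ z) * (D₀ z * D₁ z * D₂ z) := by ring
    rw [e]
    refine (norm_add₄_le).trans ?_
    have hcn : ‖(c : ℂ)‖ = c := by rw [Complex.norm_real, Real.norm_of_nonneg hc.le]
    have q₀ := hfour c _ _ _ _ hcn b₀ n₁ n₂ n₃
    have q₁ := hfour (-c) _ _ _ _ (by rw [norm_neg, hcn]) b₁ n₀ n₂ n₃
    have q₂ := hfour (c * Complex.I) _ _ _ _ (by rw [norm_mul, Complex.norm_I, hcn, mul_one])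
      b₂ n₀ n₁ n₃
    have q₃ := hfour (-c * Complex.I) _ _ _ _
      (by rw [norm_mul, norm_neg, Complex.norm_I, hcn, mul_one]) b₃ n₀ n₁ n₂
    linarith
  · have e : (1 + L / z.im) ^ 4 * ‖D₀ z * D₁ z * D₂ z * D₃ z‖ =
        ((1 + L / z.im) * ‖D₀ z‖) * ((1 + L / z.im) * ‖D₁ z‖) * ((1 + L / z.im) * ‖D₂ z‖) *
        ((1 + L / z.im) * ‖D₃ z‖) := by
      simp only [norm_mul]; ring
    rw [e]
    exact one_le_mul_of_one_le_of_one_le (one_le_mul_of_one_le_of_one_le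
      (one_le_mul_of_one_le_of_one_le l₀ l₁) l₂) l₃

end CauchyTransform

/-- A two-constants estimate at the centre of a square. -/
lemma norm_pow_four_le_of_square {Ψ : ℂ → ℂ} {w : ℂ} {r e M : ℝ} (hr : 0 < r)
    (hd : ∀ z : ℂ, |z.re - w.re| ≤ r → |z.im - w.im| ≤ r → DifferentiableAt ℂ Ψ z)
    (hM : ∀ z : ℂ, |z.re - w.re| ≤ r → |z.im - w.im| ≤ r → ‖Ψ z‖ ≤ M)
    (he : ∀ z : ℂ, |z.re - w.re| ≤ r → z.im = w.im - r → ‖Ψ z‖ ≤ e) :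
    ‖Ψ w‖ ^ 4 ≤ e * M ^ 3 := by
  set F : ℂ → ℂ := fun t => Ψ (w + t) * Ψ (w + Complex.I * t) * Ψ (w + -t) *
    Ψ (w + -(Complex.I * t)) with hF
  set U : Set ℂ := Set.Ioo (-r) r ×ℂ Set.Ioo (-r) r with hU
  have hcl : closure U = Set.Icc (-r) r ×ℂ Set.Icc (-r) r := by
    rw [hU, Complex.closure_reProdIm, closure_Ioo (by linarith)]
  have hdiff : ∀ t ∈ closure U, DifferentiableAt ℂ F t := by
    intro t ht
    rw [hcl, Complex.mem_reProdIm, Set.mem_Icc, Set.mem_Icc, ← abs_le, ← abs_le] at ht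
    obtain ⟨h1, h2⟩ := ht
    have d1 : DifferentiableAt ℂ Ψ (w + t) := hd _ (by simpa using h1) (by simpa using h2)
    have d2 : DifferentiableAt ℂ Ψ (w + Complex.I * t) :=
      hd _ (by simpa using h2) (by simpa using h1)
    have d3 : DifferentiableAt ℂ Ψ (w + -t) := hd _ (by simpa using h1) (by simpa using h2)
    have d4 : DifferentiableAt ℂ Ψ (w + -(Complex.I * t)) :=
      hd _ (by simpa using h2) (by simpa using h1)
    refine DifferentiableAt.mul (DifferentiableAt.mul (DifferentiableAt.mul ?_ ?_) ?_) ?_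
    · exact d1.comp t (by fun_prop)
    · exact d2.comp t (f := fun t => w + Complex.I * t) (by fun_prop)
    · exact d3.comp t (f := fun t => w + -t) (by fun_prop)
    · exact d4.comp t (f := fun t => w + -(Complex.I * t)) (by fun_prop)
  have hbd : Bornology.IsBounded U := by
    refine Bornology.IsBounded.reProdIm ?_ ?_ <;> exact Metric.isBounded_Ioo _ _
  have hmain : ‖F 0‖ ≤ e * M ^ 3 := by
    refine Complex.norm_le_of_forall_mem_frontier_norm_le hbd
      ⟨fun t ht => (hdiff t (subset_closure ht)).differentiableWithinAt,
        fun t ht => (hdiff t ht).continuousAt.continuousWithinAt⟩ ?_ (subset_closure ?_)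
    · intro t ht
      have htc := frontier_subset_closure ht
      rw [hcl, Complex.mem_reProdIm, Set.mem_Icc, Set.mem_Icc, ← abs_le, ← abs_le] at htc
      obtain ⟨h1, h2⟩ := htc
      have m1 : ‖Ψ (w + t)‖ ≤ M := hM _ (by simpa using h1) (by simpa using h2)
      have m2 : ‖Ψ (w + Complex.I * t)‖ ≤ M := hM _ (by simpa using h2) (by simpa using h1)
      have m3 : ‖Ψ (w + -t)‖ ≤ M := hM _ (by simpa using h1) (by simpa using h2)
      have m4 : ‖Ψ (w + -(Complex.I * t))‖ ≤ M := hM _ (by simpa using h2) (by simpa using h1)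
      have hM0 : 0 ≤ M := (norm_nonneg _).trans m1
      have prod : ∀ a b c d : ℝ, 0 ≤ a → 0 ≤ b → 0 ≤ c → 0 ≤ d → a ≤ e → b ≤ M → c ≤ M → d ≤ M →
          a * b * c * d ≤ e * M ^ 3 := by
        intro a b c d ha hb hc hd' hae hbM hcM hdM
        have he0 : 0 ≤ e := ha.trans hae
        calc a * b * c * d ≤ e * M * M * M := by gcongr
          _ = e * M ^ 3 := by ring
      have hsides : t.re = -r ∨ t.re = r ∨ t.im = -r ∨ t.im = r := by
        have hnot : t ∉ U := by
          have hopen : IsOpen U := isOpen_Ioo.reProdIm isOpen_Ioo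
          rw [hopen.frontier_eq] at ht
          exact ht.2
        rw [hU, Complex.mem_reProdIm, Set.mem_Ioo, Set.mem_Ioo] at hnot
        by_contra! hcon
        rw [abs_le] at h1 h2
        exact hnot ⟨⟨lt_of_le_of_ne h1.1 (Ne.symm hcon.1), lt_of_le_of_ne h1.2 hcon.2.1⟩,
          ⟨lt_of_le_of_ne h2.1 (Ne.symm hcon.2.2.1), lt_of_le_of_ne h2.2 hcon.2.2.2⟩⟩
      simp only [hF, norm_mul]
      rcases hsides with h | h | h | h
      · have := he (w + Complex.I * t) (by simpa using h2) (by simp [h]; ring)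
        have := prod _ _ _ _ (norm_nonneg _) (norm_nonneg _) (norm_nonneg _) (norm_nonneg _)
          this m1 m3 m4
        linarith
      · have := he (w + -(Complex.I * t)) (by simpa using h2) (by simp [h]; ring)
        have := prod _ _ _ _ (norm_nonneg _) (norm_nonneg _) (norm_nonneg _) (norm_nonneg _)
          this m1 m2 m3
        linarith
      · have := he (w + t) (by simpa using h1) (by simp [h]; ring)
        have := prod _ _ _ _ (norm_nonneg _) (norm_nonneg _) (norm_nonneg _) (norm_nonneg _)
          this m2 m3 m4
        linarith
      · have := he (w + -t) (by simpa using h1) (by simp [h]; ring)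
        have := prod _ _ _ _ (norm_nonneg _) (norm_nonneg _) (norm_nonneg _) (norm_nonneg _)
          this m1 m2 m4
        linarith
    · simp [hU, Complex.mem_reProdIm, hr]
  have : ‖F 0‖ = ‖Ψ w‖ ^ 4 := by
    simp only [hF, mul_zero, neg_zero, add_zero, norm_mul]; ring
  rwa [this] at hmain

/-- If evaluation at `ζ` is bounded on polynomials for the weighted norm, it is represented by a
positive functional on bounded functions. -/
lemma exists_representing_functional {W : ℝ → ℝ} (hWpos : ∀ x, 0 < W x)
    (hbdd : ∀ P : Polynomial ℂ, ∃ c : ℝ, ∀ x : ℝ, ‖P.eval (x : ℂ)‖ ≤ c * W x) {ζ : ℂ} {M : ℝ}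
    (hM : ∀ P : Polynomial ℂ, (∀ x : ℝ, ‖P.eval (x : ℂ)‖ ≤ W x) → ‖P.eval ζ‖ ≤ M) :
    ∃ (X : Type) (u : X → ℝ) (σ : X → ℂ) (ℓ : (X → ℂ) →ₗ[ℂ] ℂ) (L : ℝ),
      IsBoundedPositive ℓ L ∧ (∀ x, ‖σ x‖ * W (u x) ≤ 1) ∧
      ∀ P : Polynomial ℂ, ℓ (fun x => σ x * P.eval (u x : ℂ)) = P.eval ζ := by
  have hM0 : 0 ≤ M := (norm_nonneg _).trans (hM 0 fun x => by simpa using (hWpos x).le)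
  let X : Type := ℝ × {θ : ℂ // ‖θ‖ ≤ 1}
  have hX : Nonempty X := ⟨(0, ⟨0, by simp⟩)⟩
  let σ : X → ℂ := fun x => x.2.1 / (W x.1 : ℂ)
  have hσ : ∀ x : X, ‖σ x‖ * W x.1 ≤ 1 := by
    intro x
    have hW := hWpos x.1
    simp only [σ, norm_div, Complex.norm_real, Real.norm_of_nonneg hW.le]
    rw [div_mul_cancel₀ _ hW.ne']
    exact x.2.2
  let E : Submodule ℝ (X → ℝ) :=
    { carrier := {F | ∃ c : ℝ, ∀ x, |F x| ≤ c}
      zero_mem' := ⟨0, fun x => by simp⟩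
      add_mem' := by
        rintro F G ⟨c, hc⟩ ⟨d, hd⟩
        exact ⟨c + d, fun x => (abs_add_le _ _).trans (add_le_add (hc x) (hd x))⟩
      smul_mem' := by
        rintro a F ⟨c, hc⟩
        refine ⟨|a| * c, fun x => ?_⟩
        rw [Pi.smul_apply, smul_eq_mul, abs_mul]
        exact mul_le_mul_of_nonneg_left (hc x) (abs_nonneg _) }
  have hE : ∀ F : E, BddAbove (Set.range (F : X → ℝ)) := by
    rintro ⟨F, c, hc⟩
    refine ⟨c, ?_⟩
    rintro _ ⟨x, rfl⟩
    exact (le_abs_self _).trans (hc x)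
  have hσP : ∀ P : Polynomial ℂ, ∃ c : ℝ, ∀ x : X, ‖σ x * P.eval (x.1 : ℂ)‖ ≤ c := by
    intro P
    obtain ⟨c, hc⟩ := hbdd P
    refine ⟨c, fun x => ?_⟩
    have hc0 : 0 ≤ c := by
      have := (norm_nonneg _).trans (hc x.1)
      exact nonneg_of_mul_nonneg_left this (hWpos _)
    rw [norm_mul]
    calc ‖σ x‖ * ‖P.eval (x.1 : ℂ)‖ ≤ ‖σ x‖ * (c * W x.1) :=
          mul_le_mul_of_nonneg_left (hc _) (norm_nonneg _)
      _ = c * (‖σ x‖ * W x.1) := by ring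
      _ ≤ c := mul_le_of_le_one_right hc0 (hσ x)
  let T : Polynomial ℂ →ₗ[ℝ] E :=
    { toFun := fun P => ⟨fun x => (σ x * P.eval (x.1 : ℂ)).re, by
        obtain ⟨c, hc⟩ := hσP P
        exact ⟨c, fun x => (Complex.abs_re_le_norm _).trans (hc x)⟩⟩
      map_add' := by
        intro P Q
        ext x
        simp [mul_add]
      map_smul' := by
        intro a P
        ext x
        simp only [Polynomial.eval_smul, Complex.real_smul, RingHom.id_apply, Submodule.coe_smul,
          Pi.smul_apply, smul_eq_mul]
        rw [mul_left_comm, Complex.re_ofReal_mul] }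
  have hTbound : ∀ (P : Polynomial ℂ) (x : ℝ),
      ‖P.eval (x : ℂ)‖ ≤ (⨆ y, (T P : X → ℝ) y) * W x := by
    intro P x
    set p := P.eval (x : ℂ) with hp
    have hθ : ‖(starRingEnd ℂ) p / (‖p‖ : ℂ)‖ ≤ 1 := by
      rw [norm_div, RCLike.norm_conj, Complex.norm_real, norm_norm]
      exact div_self_le_one _
    have h := le_ciSup (hE (T P)) (x, ⟨_, hθ⟩)
    have hval : (T P : X → ℝ) (x, ⟨_, hθ⟩) = ‖p‖ / W x := by
      change ((starRingEnd ℂ) p / (‖p‖ : ℂ) / (W x : ℂ) * p).re = ‖p‖ / W x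
      have : (starRingEnd ℂ) p / (‖p‖ : ℂ) / (W x : ℂ) * p = ((‖p‖ / W x : ℝ) : ℂ) := by
        rcases eq_or_ne p 0 with h0 | h0
        · simp [h0]
        · have h1 : (‖p‖ : ℂ) ≠ 0 := by simpa using h0
          have h2 : (W x : ℂ) ≠ 0 := by exact_mod_cast (hWpos x).ne'
          have h3 := Complex.conj_mul' p
          push_cast
          field_simp
          rw [h3]
      rw [this, Complex.ofReal_re]
    rw [hval, div_le_iff₀ (hWpos x)] at h
    exact h
  have hTinj : Function.Injective T := by
    refine (injective_iff_map_eq_zero T).2 fun P hP => ?_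
    have hz : ∀ x : ℝ, P.eval (x : ℂ) = 0 := by
      intro x
      have := hTbound P x
      simpa [hP] using this
    refine Polynomial.eq_zero_of_infinite_isRoot P ?_
    refine (Set.infinite_range_of_injective Complex.ofReal_injective).mono ?_
    rintro _ ⟨x, rfl⟩
    exact hz x
  let φ : Polynomial ℂ →ₗ[ℝ] ℝ :=
    Complex.reLm ∘ₗ ((Polynomial.leval ζ : Polynomial ℂ →ₗ[ℂ] ℂ).restrictScalars ℝ)
  let eT := LinearEquiv.ofInjective T hTinj
  let f : E →ₗ.[ℝ] ℝ := ⟨LinearMap.range T, φ ∘ₗ eT.symm.toLinearMap⟩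
  obtain ⟨g, hgf, hgN⟩ := exists_extension_of_le_sublinear f
    (fun F : E => M * ⨆ x, (F : X → ℝ) x) (by
      intro c hc F
      have : (⨆ x, ((c • F : E) : X → ℝ) x) = c * ⨆ x, (F : X → ℝ) x := by
        rw [Real.mul_iSup_of_nonneg hc.le]
        rfl
      simp only [this]
      ring) (by
      intro F G
      rw [← mul_add]
      refine mul_le_mul_of_nonneg_left (ciSup_le fun x => ?_) hM0
      exact add_le_add (le_ciSup (hE F) x) (le_ciSup (hE G) x)) (by
      rintro ⟨_, P, rfl⟩
      have hfP : f ⟨T P, P, rfl⟩ = (P.eval ζ).re := by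
        change φ (eT.symm (eT P)) = _
        rw [LinearEquiv.symm_apply_apply]
        rfl
      change f ⟨T P, P, rfl⟩ ≤ M * ⨆ x, (T P : X → ℝ) x
      rw [hfP]
      refine (Complex.re_le_norm _).trans ?_
      have hb := hTbound P
      set s := ⨆ x, (T P : X → ℝ) x
      have hs0 : 0 ≤ s :=
        nonneg_of_mul_nonneg_left ((norm_nonneg _).trans (hb 0)) (hWpos 0)
      rcases hs0.eq_or_lt with h0 | hs
      · have : P = 0 := by
          refine Polynomial.eq_zero_of_infinite_isRoot P ?_
          refine (Set.infinite_range_of_injective Complex.ofReal_injective).mono ?_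
          rintro _ ⟨x, rfl⟩
          have := hb x
          rw [← h0, zero_mul] at this
          exact norm_le_zero_iff.1 this
        rw [this, Polynomial.eval_zero, norm_zero, ← h0, mul_zero]
      · have := hM (Polynomial.C ((s⁻¹ : ℝ) : ℂ) * P) (fun x => by
          rw [Polynomial.eval_mul, Polynomial.eval_C, norm_mul, Complex.norm_real,
            Real.norm_of_nonneg (inv_nonneg.2 hs0), inv_mul_le_iff₀ hs]
          exact hb x)
        rw [Polynomial.eval_mul, Polynomial.eval_C, norm_mul, Complex.norm_real,
          Real.norm_of_nonneg (inv_nonneg.2 hs0), inv_mul_le_iff₀ hs] at this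
        linarith)
  obtain ⟨Λ, hΛ⟩ := LinearMap.exists_extend g
  have hΛg : ∀ F : E, Λ (F : X → ℝ) = g F := fun F => LinearMap.congr_fun hΛ F
  have hΛle : ∀ (F : X → ℝ) (c : ℝ), (∃ d, ∀ x, |F x| ≤ d) → (∀ x, F x ≤ c) → Λ F ≤ M * c := by
    intro F c hF hc
    have := hgN ⟨F, hF⟩
    rw [← hΛg] at this
    exact this.trans (mul_le_mul_of_nonneg_left (ciSup_le hc) hM0)
  have hΛabs : ∀ (F : X → ℝ) (c : ℝ), (∀ x, |F x| ≤ c) → |Λ F| ≤ M * c := by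
    intro F c hc
    rw [abs_le']
    refine ⟨hΛle F c ⟨c, hc⟩ fun x => (abs_le'.1 (hc x)).1, ?_⟩
    rw [← map_neg]
    exact hΛle (-F) c ⟨c, fun x => by simpa using hc x⟩ fun x => (abs_le'.1 (hc x)).2
  let ℓ : (X → ℂ) →ₗ[ℂ] ℂ :=
    { toFun := fun F => (Λ fun x => (F x).re : ℝ) + (Λ fun x => (F x).im : ℝ) * Complex.I
      map_add' := by
        intro F G
        have h1 : (fun x => ((F + G) x).re) = (fun x => (F x).re) + fun x => (G x).re := rfl
        have h2 : (fun x => ((F + G) x).im) = (fun x => (F x).im) + fun x => (G x).im := rfl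
        rw [h1, h2, map_add, map_add]
        push_cast
        ring
      map_smul' := by
        intro a F
        have h1 : (fun x => ((a • F) x).re) =
            a.re • (fun x => (F x).re) - a.im • fun x => (F x).im := by
          funext x; simp
        have h2 : (fun x => ((a • F) x).im) =
            a.re • (fun x => (F x).im) + a.im • fun x => (F x).re := by
          funext x; simp
        rw [h1, h2, map_add, map_sub, map_smul, map_smul, map_smul, map_smul]
        apply Complex.ext <;> simp }
  have hℓre : ∀ F, (ℓ F).re = Λ fun x => (F x).re := fun F => by simp [ℓ]
  have hℓim : ∀ F, (ℓ F).im = Λ fun x => (F x).im := fun F => by simp [ℓ]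
  have hre : ∀ P : Polynomial ℂ, (Λ fun x : X => (σ x * P.eval (x.1 : ℂ)).re) = (P.eval ζ).re := by
    intro P
    have h1 : Λ (T P : X → ℝ) = g (T P) := hΛg (T P)
    have h2 : g (T P) = f ⟨T P, P, rfl⟩ := hgf ⟨T P, P, rfl⟩
    have h3 : f ⟨T P, P, rfl⟩ = (P.eval ζ).re := by
      change φ (eT.symm (eT P)) = _
      rw [LinearEquiv.symm_apply_apply]
      rfl
    rw [← h3, ← h2, ← h1]
    rfl
  refine ⟨X, fun x => x.1, σ, ℓ, 2 * M, ⟨by linarith, ?_, ?_⟩, hσ, ?_⟩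
  · intro F c hc
    refine (Complex.norm_le_abs_re_add_abs_im _).trans ?_
    rw [hℓre, hℓim]
    have h1 := hΛabs _ c fun x => (Complex.abs_re_le_norm _).trans (hc x)
    have h2 := hΛabs _ c fun x => (Complex.abs_im_le_norm _).trans (hc x)
    linarith
  · intro F c hc h0
    rw [hℓim]
    have := hΛle (-fun x => (F x).im) 0
      ⟨c, fun x => by simpa using (Complex.abs_im_le_norm _).trans (hc x)⟩
      fun x => by simpa using h0 x
    rw [map_neg] at this
    linarith
  · intro P
    apply Complex.ext
    · rw [hℓre, hre]
    · rw [hℓim]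
      have := hre (Polynomial.C (-Complex.I) * P)
      have e : (fun x : X => (σ x * (Polynomial.C (-Complex.I) * P).eval (x.1 : ℂ)).re) =
          fun x : X => (σ x * P.eval (x.1 : ℂ)).im := by
        funext x
        rw [Polynomial.eval_mul, Polynomial.eval_C, mul_left_comm]
        simp
      rw [e] at this
      rw [this, Polynomial.eval_mul, Polynomial.eval_C]
      simp

lemma norm_ofReal_sub_le_mul {x a : ℝ} {ζ z : ℂ} (hx : 2 < |x - a|) (hz : |z.re - a| ≤ 1) :
    ‖(x : ℂ) - ζ‖ ≤ 2 * (1 + ‖(a : ℂ) - ζ‖) * ‖(x : ℂ) - z‖ := by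
  have h1 : |x - z.re| ≤ ‖(x : ℂ) - z‖ := by
    simpa using Complex.abs_re_le_norm ((x : ℂ) - z)
  have h2 : |x - a| ≤ |x - z.re| + |z.re - a| := abs_sub_le _ _ _
  have h3 : ‖(x : ℂ) - ζ‖ ≤ |x - a| + ‖(a : ℂ) - ζ‖ := by
    have : ‖(x : ℂ) - a‖ = |x - a| := by
      rw [← Complex.ofReal_sub, Complex.norm_real, Real.norm_eq_abs]
    rw [← this]
    exact norm_sub_le_norm_sub_add_norm_sub _ _ _
  have h4 : |x - a| ≤ 2 * ‖(x : ℂ) - z‖ := by linarith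
  nlinarith [norm_nonneg ((a : ℂ) - ζ)]

section Vanishing

variable {W : ℝ → ℝ} {X : Type*} {u : X → ℝ} {σ : X → ℂ} {ℓ : (X → ℂ) →ₗ[ℂ] ℂ} {L : ℝ} {ζ : ℂ}

lemma norm_density_mul_le (hσ : ∀ x, ‖σ x‖ * W (u x) ≤ 1) {c : ℝ} (hc : 0 ≤ c) {x : X} {v : ℂ}
    (hv : ‖v‖ ≤ c * W (u x)) : ‖σ x * v‖ ≤ c := by
  rw [norm_mul]
  calc ‖σ x‖ * ‖v‖ ≤ ‖σ x‖ * (c * W (u x)) := mul_le_mul_of_nonneg_left hv (norm_nonneg _)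
    _ = c * (‖σ x‖ * W (u x)) := by ring
    _ ≤ c := mul_le_of_le_one_right hc (hσ x)

/-- The Cauchy transform of the annihilating density reproduces polynomials. -/
lemma eval_mul_cauchyTransform
    (hrep : ∀ P : Polynomial ℂ, ℓ (fun x => σ x * P.eval (u x : ℂ)) = P.eval ζ)
    (P : Polynomial ℂ) {z : ℂ} (hz : z.im ≠ 0) :
    P.eval z * cauchyTransform ℓ u (fun x => σ x * ((u x : ℂ) - ζ)) z =
      cauchyTransform ℓ u (fun x => σ x * (P.eval (u x : ℂ) * ((u x : ℂ) - ζ))) z := by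
  obtain ⟨Q, hQ⟩ : Polynomial.X - C z ∣ P - C (P.eval z) := by
    rw [dvd_iff_isRoot]; simp
  have h0 := hrep (Q * (Polynomial.X - C ζ))
  have hev : (Q * (Polynomial.X - C ζ)).eval ζ = 0 := by simp
  rw [hev] at h0
  rw [cauchyTransform, cauchyTransform, ← smul_eq_mul, ← map_smul, ← sub_eq_zero, ← map_sub,
    ← neg_eq_zero, ← map_neg, ← h0]
  congr 1
  funext x
  have hx := ofReal_sub_ne_zero (u x) hz
  have hQx : P.eval (u x : ℂ) - P.eval z = ((u x : ℂ) - z) * Q.eval (u x : ℂ) := by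
    have := congrArg (Polynomial.eval (u x : ℂ)) hQ
    simpa using this
  simp only [Pi.neg_apply, Pi.sub_apply, Pi.smul_apply, smul_eq_mul, eval_mul, eval_sub, eval_X,
    eval_C]
  field_simp
  linear_combination (σ x * (↑(u x) - ζ)) * hQx

lemma exists_forall_norm_eval_le_near (P : Polynomial ℂ) {a b : ℝ}
    (hP : ∀ x : ℝ, |x - a| ≤ 1 → ‖P.eval (x : ℂ)‖ ≤ b) {η : ℝ} (hη : 0 < η) :
    ∃ δ : ℝ, 0 < δ ∧ δ < 1 ∧
      ∀ z : ℂ, |z.re - a| ≤ 1 → z.im = δ → ‖P.eval z‖ ≤ b + η := by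
  have huc : UniformContinuousOn (fun z : ℂ => P.eval z) (Metric.closedBall (a : ℂ) 2) :=
    (isCompact_closedBall _ _).uniformContinuousOn_of_continuous P.continuous.continuousOn
  obtain ⟨δ, hδ, h⟩ := Metric.uniformContinuousOn_iff.1 huc η hη
  have hm : 0 < min (δ / 2) (1 / 2) := lt_min (by linarith) (by norm_num)
  refine ⟨min (δ / 2) (1 / 2), hm, (min_le_right _ _).trans_lt (by norm_num),
    fun z hz him => ?_⟩
  have hdre : dist z (z.re : ℂ) = z.im := by
    have : z - (z.re : ℂ) = z.im * Complex.I := by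
      linear_combination -Complex.re_add_im z
    rw [dist_eq_norm, this, norm_mul, Complex.norm_I, mul_one, Complex.norm_real,
      Real.norm_of_nonneg (him ▸ hm.le)]
  have hrea : dist (z.re : ℂ) (a : ℂ) ≤ 1 := by
    rw [dist_eq_norm, ← Complex.ofReal_sub, Complex.norm_real, Real.norm_eq_abs]
    exact hz
  have him2 : z.im ≤ 1 / 2 := him ▸ min_le_right _ _
  have him3 : z.im ≤ δ / 2 := him ▸ min_le_left _ _
  have h1 : z ∈ Metric.closedBall (a : ℂ) 2 := by
    rw [Metric.mem_closedBall]
    have := dist_triangle z (z.re : ℂ) (a : ℂ)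
    linarith
  have h2 : (z.re : ℂ) ∈ Metric.closedBall (a : ℂ) 2 := by
    rw [Metric.mem_closedBall]; linarith
  have := h z h1 _ h2 (by rw [hdre]; linarith)
  rw [dist_eq_norm] at this
  have h3 := hP z.re hz
  have h4 := norm_le_norm_add_norm_sub' (P.eval z) (P.eval (z.re : ℂ))
  linarith

set_option maxHeartbeats 400000 in
/-- A function in the closure of the polynomials vanishing on an interval is annihilated. -/
lemma functional_eq_zero_of_eqOn_zero (hWc : Continuous W) (hWpos : ∀ x, 0 < W x)
    (hbdd : ∀ P : Polynomial ℂ, ∃ c : ℝ, ∀ x : ℝ, ‖P.eval (x : ℂ)‖ ≤ c * W x)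
    (hℓ : IsBoundedPositive ℓ L) (hσ : ∀ x, ‖σ x‖ * W (u x) ≤ 1)
    (hrep : ∀ P : Polynomial ℂ, ℓ (fun x => σ x * P.eval (u x : ℂ)) = P.eval ζ)
    (a : ℝ) {f : ℝ → ℂ} {m : ℝ} (hm : ∀ x, ‖f x‖ ≤ m * W x) (hf : ∀ x, |x - a| ≤ 2 → f x = 0)
    (happ : ∀ ε : ℝ, 0 < ε → ∃ P : Polynomial ℂ, ∀ x : ℝ, ‖f x - P.eval (x : ℂ)‖ ≤ ε * W x) :
    ℓ (fun x => σ x * (f (u x) * ((u x : ℂ) - ζ) / ((u x : ℂ) - (a + Complex.I)))) = 0 := by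
  set w : ℂ := a + Complex.I with hw
  have hwim : w.im = 1 := by simp [hw]
  have hwre : w.re = a := by simp [hw]
  set h := ℓ (fun x => σ x * (f (u x) * ((u x : ℂ) - ζ) / ((u x : ℂ) - w))) with hh
  have hL := hℓ.nonneg
  have hm0 : 0 ≤ m := nonneg_of_mul_nonneg_left ((norm_nonneg _).trans (hm 0)) (hWpos 0)
  obtain ⟨A, hA0, hA⟩ : ∃ A : ℝ, 0 < A ∧ ∀ x, ‖σ x * ((u x : ℂ) - ζ)‖ ≤ A := by
    obtain ⟨c, hc⟩ := hbdd (Polynomial.X - C ζ)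
    have hc0 : 0 ≤ c := nonneg_of_mul_nonneg_left ((norm_nonneg _).trans (hc 0)) (hWpos 0)
    refine ⟨c + 1, by linarith, fun x => ?_⟩
    have := norm_density_mul_le hσ hc0 (x := x) (v := (u x : ℂ) - ζ) (by simpa using hc (u x))
    linarith
  obtain ⟨D₁, hD₁⟩ := exists_bounding_factor u hℓ hA0 hA
  obtain ⟨N, hN⟩ : ∃ N : ℝ, ∀ x : ℝ, |x - a| ≤ 1 → W x ≤ N := by
    obtain ⟨N, hN⟩ := (isCompact_closedBall a 1).bddAbove_image hWc.continuousOn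
    exact ⟨N, fun x hx => hN ⟨x, by rwa [Metric.mem_closedBall, Real.dist_eq], rfl⟩⟩
  have hN0 : 0 < N := (hWpos a).trans_le (hN a (by simp))
  set J := 2 + ‖(a : ℂ) - ζ‖ with hJ
  have hJ0 : 0 < J := by positivity
  set B := 2 * (1 + ‖(a : ℂ) - ζ‖) with hB
  have hB0 : 0 < B := by positivity
  set B' := 1 + ‖w - ζ‖ with hB'
  have key : ∃ K : ℝ, ∀ ε : ℝ, 0 < ε → ε ≤ 1 → ∃ y : ℝ, 0 ≤ y ∧ y ^ 4 ≤ K * ε ∧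
      ‖h‖ ≤ y + B' * L * ε := by
    refine ⟨(N + 1) * (8 * A) * (8 * J + B * (m + 1) * L) ^ 3 * (1 + L) ^ 32,
      fun ε hε hε1 => ?_⟩
    obtain ⟨P, hP⟩ := happ ε hε
    set G := cauchyTransform ℓ u (fun x => σ x * ((u x : ℂ) - ζ)) with hG
    refine ⟨‖P.eval w * G w‖, norm_nonneg _, ?_, ?_⟩
    · set k : X → ℂ := fun x => σ x * (P.eval (u x : ℂ) * ((u x : ℂ) - ζ)) with hk
      classical
      set kin : X → ℂ := fun x => if |u x - a| ≤ 2 then k x else 0 with hkin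
      set kout : X → ℂ := fun x => if |u x - a| ≤ 2 then 0 else k x with hkout
      have hkin_le : ∀ x, ‖kin x‖ ≤ ε * J := by
        intro x
        simp only [hkin]
        split_ifs with hx
        · refine norm_density_mul_le hσ (by positivity) ?_
          have h1 := hP (u x)
          rw [hf _ hx, zero_sub, norm_neg] at h1
          have h2 : ‖(u x : ℂ) - ζ‖ ≤ J := by
            have e : ‖(u x : ℂ) - a‖ = |u x - a| := by
              rw [← Complex.ofReal_sub, Complex.norm_real, Real.norm_eq_abs]
            have := norm_sub_le_norm_sub_add_norm_sub (u x : ℂ) a ζ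
            linarith
          rw [norm_mul]
          calc ‖P.eval (u x : ℂ)‖ * ‖(u x : ℂ) - ζ‖ ≤ ε * W (u x) * J :=
                mul_le_mul h1 h2 (norm_nonneg _) ((norm_nonneg _).trans h1)
            _ = ε * J * W (u x) := by ring
        · rw [norm_zero]; positivity
      obtain ⟨D₂, hD₂⟩ := exists_bounding_factor u hℓ (mul_pos hε hJ0) hkin_le
      have hout : ∀ z : ℂ, |z.re - a| ≤ 1 → 0 < z.im →
          ‖cauchyTransform ℓ u kout z‖ ≤ B * (m + 1) * L := by
        intro z hz hz0
        refine hℓ.norm_le _ _ fun x => ?_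
        simp only [hkout]
        split_ifs with hx
        · rw [zero_div, norm_zero]; positivity
        · rw [mul_div_assoc]
          refine norm_density_mul_le hσ (by positivity) ?_
          have h1 := norm_ofReal_sub_le_mul (ζ := ζ) (not_le.1 hx) hz
          have h2 : 0 < ‖(u x : ℂ) - z‖ := norm_pos_iff.2 (ofReal_sub_ne_zero _ hz0.ne')
          have h3 : ‖P.eval (u x : ℂ)‖ ≤ (m + 1) * W (u x) := by
            have := norm_le_norm_add_norm_sub (f (u x)) (P.eval (u x : ℂ))
            have h5 := hP (u x)
            have h6 := hm (u x)
            have h7 := mul_le_of_le_one_left (hWpos (u x)).le hε1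
            rw [add_mul, one_mul]
            linarith
          rw [norm_div, norm_mul, div_le_iff₀ h2]
          calc ‖P.eval (u x : ℂ)‖ * ‖(u x : ℂ) - ζ‖ ≤ (m + 1) * W (u x) * (B * ‖(u x : ℂ) - z‖) :=
                mul_le_mul h3 h1 (norm_nonneg _) ((norm_nonneg _).trans h3)
            _ = B * (m + 1) * W (u x) * ‖(u x : ℂ) - z‖ := by ring
      have hPG : ∀ z : ℂ, 0 < z.im → P.eval z * G z =
          cauchyTransform ℓ u kin z + cauchyTransform ℓ u kout z := by
        intro z hz
        rw [hG, eval_mul_cauchyTransform hrep P hz.ne', ← cauchyTransform_add]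
        congr 1
        funext x
        simp only [hkin, hkout]
        split_ifs <;> simp [hk]
      obtain ⟨δ, hδ0, hδ1, hδ⟩ := exists_forall_norm_eval_le_near P (a := a) (b := ε * N)
        (fun x hx => by
          have h1 := hP x
          rw [hf x (by linarith), zero_sub, norm_neg] at h1
          exact h1.trans (mul_le_mul_of_nonneg_left (hN x hx) hε.le)) hε
      have hsq := norm_pow_four_le_of_square (Ψ := fun z => P.eval z * G z * (D₁ z * D₂ z))
        (w := w) (r := 1 - δ) (e := (ε * N + ε) * (8 * A)) (M := 8 * J + B * (m + 1) * L)
        (by linarith)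
        (by
          intro z hz1 hz2
          rw [hwim] at hz2
          have hz0 : 0 < z.im := by linarith [(abs_le.1 hz2).1]
          exact (P.differentiable.differentiableAt.mul
            (cauchyTransform_differentiableAt u hℓ hA hz0)).mul
            ((hD₁ z hz0).1.mul (hD₂ z hz0).1))
        (by
          intro z hz1 hz2
          rw [hwim] at hz2
          rw [hwre] at hz1
          have hz0 : 0 < z.im := by linarith [(abs_le.1 hz2).1]
          obtain ⟨-, n₁, b₁, -⟩ := hD₁ z hz0
          obtain ⟨-, n₂, b₂, -⟩ := hD₂ z hz0
          have ho := hout z (by linarith) hz0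
          have e : P.eval z * G z * (D₁ z * D₂ z) =
              cauchyTransform ℓ u kin z * D₂ z * D₁ z +
              cauchyTransform ℓ u kout z * (D₁ z * D₂ z) := by
            rw [hPG z hz0]; ring
          simp only [e]
          refine (norm_add_le _ _).trans (add_le_add ?_ ?_)
          · rw [norm_mul]
            calc _ ≤ 8 * (ε * J) * 1 := mul_le_mul b₂ n₁ (norm_nonneg _) (by positivity)
              _ ≤ 8 * J := by linarith [mul_le_of_le_one_left hJ0.le hε1]
          · rw [norm_mul]
            refine (mul_le_of_le_one_right (norm_nonneg _) ?_).trans ho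
            rw [norm_mul]
            exact mul_le_one₀ n₁ (norm_nonneg _) n₂)
        (by
          intro z hz1 hz2
          rw [hwim] at hz2
          rw [hwre] at hz1
          have hz0 : 0 < z.im := by linarith
          obtain ⟨-, n₁, b₁, -⟩ := hD₁ z hz0
          obtain ⟨-, n₂, b₂, -⟩ := hD₂ z hz0
          have hp := hδ z (by linarith) (by linarith)
          have e : P.eval z * G z * (D₁ z * D₂ z) = P.eval z * (G z * D₁ z) * D₂ z := by ring
          simp only [e]
          rw [norm_mul, norm_mul]
          refine (mul_le_of_le_one_right (by positivity) n₂).trans ?_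
          exact mul_le_mul hp b₁ (norm_nonneg _) (by positivity))
      obtain ⟨-, -, -, l₁⟩ := hD₁ w (by rw [hwim]; exact one_pos)
      obtain ⟨-, -, -, l₂⟩ := hD₂ w (by rw [hwim]; exact one_pos)
      rw [hwim, div_one] at l₁ l₂
      have hlow : ‖P.eval w * G w‖ ≤ (1 + L) ^ 8 * ‖P.eval w * G w * (D₁ w * D₂ w)‖ := by
        have h1 := one_le_mul_of_one_le_of_one_le l₁ l₂
        have e : (1 + L) ^ 8 * ‖P.eval w * G w * (D₁ w * D₂ w)‖ = ‖P.eval w * G w‖ *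
            ((1 + L) ^ 4 * ‖D₁ w‖ * ((1 + L) ^ 4 * ‖D₂ w‖)) := by
          rw [norm_mul (P.eval w * G w), norm_mul (D₁ w)]
          generalize 1 + L = R
          ring
        rw [e]
        exact le_mul_of_one_le_right (norm_nonneg _) h1
      calc ‖P.eval w * G w‖ ^ 4 ≤ ((1 + L) ^ 8 * ‖P.eval w * G w * (D₁ w * D₂ w)‖) ^ 4 :=
            pow_le_pow_left₀ (norm_nonneg _) hlow 4
        _ = (1 + L) ^ 32 * ‖P.eval w * G w * (D₁ w * D₂ w)‖ ^ 4 := by rw [mul_pow, ← pow_mul]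
        _ ≤ (1 + L) ^ 32 * ((ε * N + ε) * (8 * A) * (8 * J + B * (m + 1) * L) ^ 3) :=
            mul_le_mul_of_nonneg_left hsq (by positivity)
        _ = (N + 1) * (8 * A) * (8 * J + B * (m + 1) * L) ^ 3 * (1 + L) ^ 32 * ε := by
          generalize (8 * J + B * (m + 1) * L) ^ 3 = S
          generalize (1 + L) ^ 32 = R
          ring
    · rw [hG, eval_mul_cauchyTransform hrep P (by rw [hwim]; exact one_ne_zero)]
      refine (norm_le_norm_add_norm_sub' _ _).trans (add_le_add_right ?_ _)
      rw [hh, cauchyTransform, ← map_sub]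
      refine (hℓ.norm_le _ (B' * ε) fun x => ?_).trans (le_of_eq (by ring))
      have e : ((fun x => σ x * (f (u x) * ((u x : ℂ) - ζ) / ((u x : ℂ) - w))) -
          fun x => σ x * (P.eval (u x : ℂ) * ((u x : ℂ) - ζ)) / ((u x : ℂ) - w)) x =
          σ x * ((f (u x) - P.eval (u x : ℂ)) * ((u x : ℂ) - ζ) / ((u x : ℂ) - w)) := by
        simp only [Pi.sub_apply]; ring
      rw [e]
      refine norm_density_mul_le hσ (by positivity) ?_
      have h1 : 1 ≤ ‖(u x : ℂ) - w‖ := by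
        have := im_le_norm_ofReal_sub (u x) w
        rwa [hwim, abs_one] at this
      rw [norm_div, norm_mul, div_le_iff₀ (by linarith)]
      have h2 : ‖(u x : ℂ) - ζ‖ ≤ B' * ‖(u x : ℂ) - w‖ := by
        have h3 := norm_sub_le_norm_sub_add_norm_sub (u x : ℂ) w ζ
        have h4 := le_mul_of_one_le_right (norm_nonneg (w - ζ)) h1
        rw [hB', add_mul, one_mul]
        linarith
      calc _ ≤ ε * W (u x) * (B' * ‖(u x : ℂ) - w‖) :=
            mul_le_mul (hP _) h2 (norm_nonneg _) ((norm_nonneg _).trans (hP (u x)))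
        _ = B' * ε * W (u x) * ‖(u x : ℂ) - w‖ := by ring
  obtain ⟨K, key⟩ := key
  by_contra hne
  have hpos : 0 < ‖h‖ := norm_pos_iff.2 hne
  have hev : ∀ᶠ ε : ℝ in nhdsWithin 0 (Set.Ioi 0),
      B' * L * ε < ‖h‖ / 2 ∧ K * ε < (‖h‖ / 2) ^ 4 ∧ ε ≤ 1 := by
    have lim : ∀ c : ℝ, Tendsto (fun ε : ℝ => c * ε) (nhdsWithin 0 (Set.Ioi 0)) (nhds 0) := by
      intro c
      have : Tendsto (fun ε : ℝ => c * ε) (nhds 0) (nhds (c * 0)) :=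
        (continuous_const_mul c).tendsto 0
      rw [mul_zero] at this
      exact this.mono_left nhdsWithin_le_nhds
    have h1 := (lim 1).eventually_le_const (show (0 : ℝ) < 1 from one_pos)
    filter_upwards [(lim (B' * L)).eventually_lt_const (half_pos hpos),
      (lim K).eventually_lt_const (show (0 : ℝ) < (‖h‖ / 2) ^ 4 by positivity), h1]
      with ε e1 e2 e3
    exact ⟨e1, e2, by simpa using e3⟩
  obtain ⟨ε, ⟨e1, e2, e3⟩, e4⟩ := (hev.and self_mem_nhdsWithin).exists
  obtain ⟨y, hy0, hy4, hy⟩ := key ε e4 e3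
  have : ‖h‖ / 2 ≤ y := by linarith
  have := pow_le_pow_left₀ (by positivity) this 4
  linarith

end Vanishing

section Growth

variable {W : ℝ → ℝ}

lemma exists_norm_eval_le_mul_weight (hWc : Continuous W) (hWpos : ∀ x, 0 < W x)
    (hWgrow : ∀ n : ℕ, Tendsto (fun x : ℝ => x ^ n / W x) (cocompact ℝ) (nhds 0))
    (P : Polynomial ℂ) : ∃ c : ℝ, ∀ x : ℝ, ‖P.eval (x : ℂ)‖ ≤ c * W x := by
  have hpow : ∀ n : ℕ, ∃ c : ℝ, ∀ x : ℝ, |x| ^ n ≤ c * W x := by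
    intro n
    let F : ZeroAtInftyContinuousMap ℝ ℝ :=
      ⟨⟨fun x => x ^ n / W x, (continuous_pow n).div hWc fun x => (hWpos x).ne'⟩, hWgrow n⟩
    refine ⟨‖F.toBCF‖, fun x => ?_⟩
    have h : ‖x ^ n / W x‖ ≤ ‖F.toBCF‖ := F.toBCF.norm_coe_le_norm x
    rwa [norm_div, norm_pow, Real.norm_eq_abs, Real.norm_of_nonneg (hWpos x).le,
      div_le_iff₀ (hWpos x)] at h
  induction P using Polynomial.induction_on' with
  | add p q hp hq =>
    obtain ⟨c, hc⟩ := hp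
    obtain ⟨d, hd⟩ := hq
    refine ⟨c + d, fun x => ?_⟩
    rw [eval_add, add_mul]
    exact (norm_add_le _ _).trans (add_le_add (hc x) (hd x))
  | monomial n a =>
    obtain ⟨c, hc⟩ := hpow n
    refine ⟨‖a‖ * c, fun x => ?_⟩
    rw [eval_monomial, norm_mul, norm_pow, Complex.norm_real, Real.norm_eq_abs, mul_assoc]
    exact mul_le_mul_of_nonneg_left (hc x) (norm_nonneg _)

lemma memC0_of_bounded (hWpos : ∀ x, 0 < W x)
    (hWgrow : ∀ n : ℕ, Tendsto (fun x : ℝ => x ^ n / W x) (cocompact ℝ) (nhds 0))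
    {f : ℝ → ℂ} (hf : Continuous f) {c : ℝ} (hc : ∀ x, ‖f x‖ ≤ c) : MemC0 W f := by
  refine ⟨hf, ?_⟩
  have h := (hWgrow 0).const_mul c
  rw [mul_zero] at h
  refine squeeze_zero (fun x => div_nonneg (norm_nonneg _) (hWpos x).le) (fun x => ?_) h
  rw [pow_zero, mul_one_div]
  exact div_le_div_of_nonneg_right (hc x) (hWpos x).le

lemma hallMajorant_eq_top_of_polysDense (hWc : Continuous W) (hWpos : ∀ x, 0 < W x)
    (hWgrow : ∀ n : ℕ, Tendsto (fun x : ℝ => x ^ n / W x) (cocompact ℝ) (nhds 0))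
    (hdense : PolysDense W) {ζ : ℂ} (hζ : ζ.im ≠ 0) : hallMajorant W ζ = ⊤ := by
  by_contra hne
  have hbdd := exists_norm_eval_le_mul_weight hWc hWpos hWgrow
  have hM : ∀ P : Polynomial ℂ, (∀ x : ℝ, ‖P.eval (x : ℂ)‖ ≤ W x) →
      ‖P.eval ζ‖ ≤ (hallMajorant W ζ).toReal := by
    intro P hP
    have h : (‖P.eval ζ‖₊ : ℝ≥0∞) ≤ hallMajorant W ζ :=
      le_iSup (fun P : {P : Polynomial ℂ // ∀ x : ℝ, ‖P.eval (x : ℂ)‖ ≤ W x} =>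
        (‖(P : Polynomial ℂ).eval ζ‖₊ : ℝ≥0∞)) ⟨P, hP⟩
    exact ENNReal.toReal_mono hne h
  obtain ⟨X, u, σ, ℓ, L, hℓ, hσ, hrep⟩ := exists_representing_functional hWpos hbdd hM
  obtain ⟨c, hc⟩ := hbdd 1
  have hc0 : 0 ≤ c := nonneg_of_mul_nonneg_left ((norm_nonneg _).trans (hc 0)) (hWpos 0)
  have hvanish : ∀ (a : ℝ) (g : ℝ → ℂ), Continuous g → (∀ x, ‖g x‖ ≤ 1) →
      (∀ x, |x - a| ≤ 2 → g x = 0) → ℓ (fun x => σ x * g (u x)) = 0 := by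
    intro a g hg hg1 hga
    set w : ℂ := a + Complex.I with hw
    have hwim : w.im ≠ 0 := by simp [hw]
    set f : ℝ → ℂ := fun x => g x * ((x : ℂ) - w) / ((x : ℂ) - ζ) with hf
    have hfc : Continuous f :=
      (hg.mul (by fun_prop)).div (by fun_prop) fun x => ofReal_sub_ne_zero x hζ
    have hfb : ∀ x, ‖f x‖ ≤ 1 + ‖ζ - w‖ / |ζ.im| := by
      intro x
      have h1 := im_le_norm_ofReal_sub x ζ
      have h2 : 0 < |ζ.im| := abs_pos.2 hζ
      have h3 := norm_sub_le_norm_sub_add_norm_sub (x : ℂ) ζ w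
      rw [hf, norm_div, norm_mul, div_le_iff₀ (h2.trans_le h1), add_mul, one_mul]
      have h4 : ‖ζ - w‖ ≤ ‖ζ - w‖ / |ζ.im| * ‖(x : ℂ) - ζ‖ := by
        rw [div_mul_eq_mul_div, le_div_iff₀ h2]
        exact mul_le_mul_of_nonneg_left h1 (norm_nonneg _)
      have h5 := mul_le_of_le_one_left (norm_nonneg ((x : ℂ) - w)) (hg1 x)
      linarith
    have h := functional_eq_zero_of_eqOn_zero hWc hWpos hbdd hℓ hσ hrep a
      (f := f) (m := (1 + ‖ζ - w‖ / |ζ.im|) * c) (fun x => by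
        rw [mul_assoc]
        have := hc x
        rw [eval_one, norm_one] at this
        exact (hfb x).trans (le_mul_of_one_le_right (by positivity) this))
      (fun x hx => by simp [hf, hga x hx])
      (hdense f (memC0_of_bounded hWpos hWgrow hfc hfb))
    rw [← h]
    congr 1
    funext x
    have h1 := ofReal_sub_ne_zero (u x) hζ
    have h2 := ofReal_sub_ne_zero (u x) hwim
    simp only [hf, ← hw]
    field_simp
  set g : ℝ → ℝ := fun x => max 0 (min 1 (|x| - 2)) with hg
  have hgc : Continuous g := by fun_prop
  have hg0 : ∀ x, 0 ≤ g x := fun x => le_max_left _ _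
  have hg1 : ∀ x, g x ≤ 1 := fun x => max_le zero_le_one (min_le_left _ _)
  have e1 := hvanish 0 (fun x => (g x : ℂ)) (by fun_prop)
    (fun x => by rw [Complex.norm_real, Real.norm_of_nonneg (hg0 x)]; exact hg1 x)
    (fun x hx => by
      rw [sub_zero] at hx
      have : g x = 0 := max_eq_left ((min_le_right _ _).trans (by linarith))
      simp [this])
  have e2 := hvanish 10 (fun x => ((1 - g x : ℝ) : ℂ)) (by fun_prop)
    (fun x => by
      rw [Complex.norm_real, Real.norm_of_nonneg (by linarith [hg1 x])]
      linarith [hg0 x])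
    (fun x hx => by
      have h8 : 1 ≤ |x| - 2 := by
        have := (abs_le.1 hx).1
        have := le_abs_self x
        linarith
      have : g x = 1 := by rw [hg]; simp [min_eq_left h8]
      simp [this])
  have e3 := hrep 1
  have e4 : (fun x => σ x * (1 : Polynomial ℂ).eval (u x : ℂ)) =
      (fun x => σ x * (g (u x) : ℂ)) + fun x => σ x * ((1 - g (u x) : ℝ) : ℂ) := by
    funext x
    simp only [eval_one, Pi.add_apply]
    push_cast
    ring
  rw [e4, map_add, e1, e2, eval_one, add_zero] at e3
  exact zero_ne_one e3

/-- `f` belongs to the closure of the polynomials in the weighted supremum norm. -/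
def IsPolyLimit (W : ℝ → ℝ) (f : ℝ → ℂ) : Prop :=
  ∀ ε : ℝ, 0 < ε → ∃ P : Polynomial ℂ, ∀ x : ℝ, ‖f x - P.eval (x : ℂ)‖ ≤ ε * W x

namespace IsPolyLimit

lemma of_approx {f : ℝ → ℂ}
    (h : ∀ ε : ℝ, 0 < ε → ∃ g, IsPolyLimit W g ∧ ∀ x : ℝ, ‖f x - g x‖ ≤ ε * W x) :
    IsPolyLimit W f := by
  intro ε hε
  obtain ⟨g, hg, hfg⟩ := h (ε / 2) (half_pos hε)
  obtain ⟨P, hP⟩ := hg (ε / 2) (half_pos hε)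
  refine ⟨P, fun x => (norm_sub_le_norm_sub_add_norm_sub _ (g x) _).trans ?_⟩
  linarith [hfg x, hP x]

lemma polynomial (hWpos : ∀ x, 0 < W x) (P : Polynomial ℂ) :
    IsPolyLimit W fun x => P.eval (x : ℂ) := fun ε hε =>
  ⟨P, fun x => by
    rw [sub_self, norm_zero]
    exact mul_nonneg hε.le (hWpos x).le⟩

lemma add {f g : ℝ → ℂ} (hf : IsPolyLimit W f) (hg : IsPolyLimit W g) :
    IsPolyLimit W fun x => f x + g x := by
  intro ε hε
  obtain ⟨P, hP⟩ := hf (ε / 2) (half_pos hε)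
  obtain ⟨Q, hQ⟩ := hg (ε / 2) (half_pos hε)
  refine ⟨P + Q, fun x => ?_⟩
  rw [eval_add, add_sub_add_comm]
  refine (norm_add_le _ _).trans ?_
  linarith [hP x, hQ x]

lemma const_mul (a : ℂ) {f : ℝ → ℂ} (hWpos : ∀ x, 0 < W x) (hf : IsPolyLimit W f) :
    IsPolyLimit W fun x => a * f x := by
  intro ε hε
  have ha : 0 < ‖a‖ + 1 := by positivity
  obtain ⟨P, hP⟩ := hf (ε / (‖a‖ + 1)) (div_pos hε ha)
  refine ⟨C a * P, fun x => ?_⟩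
  rw [eval_mul, eval_C, ← mul_sub, norm_mul]
  have h0 : 0 ≤ ε / (‖a‖ + 1) * W x := mul_nonneg (div_pos hε ha).le (hWpos x).le
  calc ‖a‖ * ‖f x - P.eval (x : ℂ)‖ ≤ (‖a‖ + 1) * (ε / (‖a‖ + 1) * W x) :=
        mul_le_mul (by linarith) (hP x) (norm_nonneg _) ha.le
    _ = ε * W x := by field_simp

lemma conj {f : ℝ → ℂ} (hf : IsPolyLimit W f) :
    IsPolyLimit W fun x => (starRingEnd ℂ) (f x) := by
  intro ε hε
  obtain ⟨P, hP⟩ := hf ε hε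
  refine ⟨P.map (starRingEnd ℂ), fun x => ?_⟩
  have : (P.map (starRingEnd ℂ)).eval (x : ℂ) = (starRingEnd ℂ) (P.eval (x : ℂ)) := by
    conv_lhs => rw [← Complex.conj_ofReal x]
    rw [eval_map, eval₂_hom]
  rw [this, ← map_sub, RCLike.norm_conj]
  exact hP x

/-- The closure of the polynomials is stable under multiplication by a resolvent it contains. -/
lemma mul_resolvent {ζ : ℂ} (hζ : ζ.im ≠ 0) (hWpos : ∀ x, 0 < W x)
    (hr : IsPolyLimit W fun x => ((x : ℂ) - ζ)⁻¹) {f : ℝ → ℂ} (hf : IsPolyLimit W f) :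
    IsPolyLimit W fun x => f x * ((x : ℂ) - ζ)⁻¹ := by
  refine of_approx fun ε hε => ?_
  have h0 : 0 < |ζ.im| := abs_pos.2 hζ
  obtain ⟨P, hP⟩ := hf (ε * |ζ.im|) (mul_pos hε h0)
  refine ⟨fun x => P.eval (x : ℂ) * ((x : ℂ) - ζ)⁻¹, ?_, fun x => ?_⟩
  · obtain ⟨Q, hQ⟩ : Polynomial.X - C ζ ∣ P - C (P.eval ζ) := by
      rw [dvd_iff_isRoot]; simp
    have e : (fun x : ℝ => P.eval (x : ℂ) * ((x : ℂ) - ζ)⁻¹) =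
        fun x : ℝ => Q.eval (x : ℂ) + P.eval ζ * ((x : ℂ) - ζ)⁻¹ := by
      funext x
      have hx := ofReal_sub_ne_zero x hζ
      have := congrArg (Polynomial.eval (x : ℂ)) hQ
      simp only [eval_sub, eval_C, eval_mul, eval_X] at this
      field_simp
      linear_combination this
    rw [e]
    exact (polynomial hWpos Q).add (hr.const_mul _ hWpos)
  · have h1 := im_le_norm_ofReal_sub x ζ
    rw [← sub_mul, norm_mul, norm_inv, ← div_eq_mul_inv, div_le_iff₀ (h0.trans_le h1)]
    have h2 := hP x
    have h3 := mul_le_mul_of_nonneg_left h1 (mul_nonneg hε.le (hWpos x).le)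
    linarith

end IsPolyLimit

lemma isPolyLimit_resolvent (hWpos : ∀ x, 0 < W x) {ζ : ℂ} (hζ : ζ.im ≠ 0)
    (hall : hallMajorant W ζ = ⊤) : IsPolyLimit W fun x => ((x : ℂ) - ζ)⁻¹ := by
  intro ε hε
  have h0 : 0 < |ζ.im| := abs_pos.2 hζ
  set N : ℝ := 1 / (ε * |ζ.im|) with hN
  have hN0 : 0 < N := by positivity
  obtain ⟨⟨P, hP⟩, hPN⟩ := iSup_eq_top.1 hall (ENNReal.ofReal N) ENNReal.ofReal_lt_top
  replace hPN : N < ‖P.eval ζ‖ := by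
    have h : ENNReal.ofReal N < (‖P.eval ζ‖₊ : ℝ≥0∞) := hPN
    rw [← enorm_eq_nnnorm, ← ofReal_norm] at h
    exact (ENNReal.ofReal_lt_ofReal_iff_of_nonneg hN0.le).1 h
  have hne : P.eval ζ ≠ 0 := norm_pos_iff.1 (hN0.trans hPN)
  obtain ⟨Q, hQ⟩ : Polynomial.X - C ζ ∣ P - C (P.eval ζ) := by
    rw [dvd_iff_isRoot]; simp
  refine ⟨C (-(P.eval ζ)⁻¹) * Q, fun x => ?_⟩
  have hx := ofReal_sub_ne_zero x hζ
  have e : ((x : ℂ) - ζ)⁻¹ - (C (-(P.eval ζ)⁻¹) * Q).eval (x : ℂ) =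
      P.eval (x : ℂ) / (P.eval ζ * ((x : ℂ) - ζ)) := by
    have := congrArg (Polynomial.eval (x : ℂ)) hQ
    simp only [eval_sub, eval_C, eval_mul, eval_X] at this
    rw [eval_mul, eval_C]
    field_simp
    linear_combination -this
  have h1 := im_le_norm_ofReal_sub x ζ
  have h2 : 1 / ε ≤ ‖P.eval ζ * ((x : ℂ) - ζ)‖ := by
    rw [norm_mul]
    calc 1 / ε = N * |ζ.im| := by rw [hN]; field_simp
      _ ≤ _ := mul_le_mul hPN.le h1 h0.le (norm_nonneg _)
  rw [e, norm_div, div_le_iff₀ ((by positivity : 0 < 1 / ε).trans_le h2)]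
  refine (hP x).trans ?_
  calc W x = ε * W x * (1 / ε) := by field_simp
    _ ≤ _ := mul_le_mul_of_nonneg_left h2 (mul_nonneg hε.le (hWpos x).le)

lemma tendsto_resolvent_cocompact (ζ : ℂ) :
    Tendsto (fun x : ℝ => ((x : ℂ) - ζ)⁻¹) (cocompact ℝ) (nhds 0) := by
  rw [tendsto_zero_iff_norm_tendsto_zero]
  simp only [norm_inv]
  refine tendsto_inv_atTop_zero.comp ?_
  refine tendsto_atTop_mono (fun x => ?_)
    (tendsto_atTop_add_const_right _ (-‖ζ‖) (tendsto_norm_cocompact_atTop (E := ℝ)))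
  have := norm_sub_norm_le (x : ℂ) ζ
  rwa [Complex.norm_real] at this

lemma isPolyLimit_of_onePoint (hWpos : ∀ x, 0 < W x) {c : ℝ} (hc : ∀ x, 1 ≤ c * W x) {ζ : ℂ}
    (hζ : ζ.im ≠ 0) (hr : IsPolyLimit W fun x => ((x : ℂ) - ζ)⁻¹) (F : C(OnePoint ℝ, ℂ)) :
    IsPolyLimit W fun x => F x := by
  have hrc : Continuous fun x : ℝ => ((x : ℂ) - ζ)⁻¹ :=
    Continuous.inv₀ (by fun_prop) fun x => ofReal_sub_ne_zero x hζ
  let r : C(OnePoint ℝ, ℂ) := OnePoint.continuousMapMk ⟨_, hrc⟩ 0 (by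
    rw [Filter.coclosedCompact_eq_cocompact]
    exact tendsto_resolvent_cocompact ζ)
  let A : StarSubalgebra ℂ C(OnePoint ℝ, ℂ) := StarAlgebra.adjoin ℂ {r}
  have hA : ∀ G ∈ A, ∀ f : ℝ → ℂ, IsPolyLimit W f → IsPolyLimit W fun x => f x * G x := by
    intro G hG
    induction hG using StarAlgebra.adjoin_induction with
    | mem G hG =>
      rw [Set.mem_singleton_iff] at hG
      subst hG
      exact fun f hf => IsPolyLimit.mul_resolvent hζ hWpos hr hf
    | algebraMap a =>
      intro f hf
      have := hf.const_mul a hWpos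
      simpa [mul_comm] using this
    | add G H _ _ hG hH =>
      intro f hf
      have := (hG f hf).add (hH f hf)
      simpa [mul_add] using this
    | mul G H _ _ hG hH =>
      intro f hf
      have := hH _ (hG f hf)
      simpa [mul_assoc] using this
    | star G _ hG =>
      intro f hf
      have := (hG _ hf.conj).conj
      simpa using this
  have hsep : A.SeparatesPoints := by
    intro x y hxy
    refine ⟨r, ⟨r, StarAlgebra.subset_adjoin ℂ _ rfl, rfl⟩, ?_⟩
    induction x using OnePoint.rec with
    | infty =>
      induction y using OnePoint.rec with
      | infty => exact absurd rfl hxy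
      | coe y => exact (inv_ne_zero (ofReal_sub_ne_zero y hζ)).symm
    | coe x =>
      induction y using OnePoint.rec with
      | infty => exact inv_ne_zero (ofReal_sub_ne_zero x hζ)
      | coe y =>
        intro h
        have h' : ((x : ℂ) - ζ)⁻¹ = ((y : ℂ) - ζ)⁻¹ := h
        rw [inv_inj, sub_left_inj, Complex.ofReal_inj] at h'
        exact hxy (by rw [h'])
  have htop := ContinuousMap.starSubalgebra_topologicalClosure_eq_top_of_separatesPoints A hsep
  have hF : F ∈ closure (A : Set C(OnePoint ℝ, ℂ)) := by
    rw [← StarSubalgebra.topologicalClosure_coe, htop]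
    trivial
  have hc0 : 0 < c := pos_of_mul_pos_left (one_pos.trans_le (hc 0)) (hWpos 0).le
  refine IsPolyLimit.of_approx fun ε hε => ?_
  obtain ⟨G, hG, hFG⟩ := Metric.mem_closure_iff.1 hF (ε / c) (div_pos hε hc0)
  refine ⟨fun x => G x, ?_, fun x => ?_⟩
  · have := hA G hG _ (IsPolyLimit.polynomial hWpos 1)
    simpa using this
  · have h1 : dist (F x) (G x) ≤ ε / c := (ContinuousMap.dist_apply_le_dist _).trans hFG.le
    rw [dist_eq_norm] at h1
    refine h1.trans ?_
    calc ε / c = ε / c * 1 := (mul_one _).symm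
      _ ≤ ε / c * (c * W x) := mul_le_mul_of_nonneg_left (hc x) (div_pos hε hc0).le
      _ = ε * W x := by field_simp

lemma polysDense_of_hallMajorant_eq_top (hWc : Continuous W) (hWpos : ∀ x, 0 < W x)
    (hWgrow : ∀ n : ℕ, Tendsto (fun x : ℝ => x ^ n / W x) (cocompact ℝ) (nhds 0))
    {ζ : ℂ} (hζ : ζ.im ≠ 0) (hall : hallMajorant W ζ = ⊤) : PolysDense W := by
  intro f hf
  obtain ⟨c, hc⟩ := exists_norm_eval_le_mul_weight hWc hWpos hWgrow 1
  simp only [eval_one, norm_one] at hc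
  have hr := isPolyLimit_resolvent hWpos hζ hall
  change IsPolyLimit W f
  refine IsPolyLimit.of_approx fun ε hε => ?_
  have hev := hf.2.eventually_lt_const hε
  rw [← Metric.cobounded_eq_cocompact,
    (Metric.hasBasis_cobounded_compl_closedBall (0 : ℝ)).eventually_iff] at hev
  obtain ⟨R, -, hR⟩ := hev
  set χ : ℝ → ℝ := fun x => max 0 (min 1 (R + 1 - |x|)) with hχ
  have hχ0 : ∀ x, 0 ≤ χ x := fun x => le_max_left _ _
  have hχ1 : ∀ x, χ x ≤ 1 := fun x => max_le zero_le_one (min_le_left _ _)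
  have hfχ : Continuous fun x => f x * (χ x : ℂ) := hf.1.mul (by fun_prop)
  have hlim : Tendsto (fun x => f x * (χ x : ℂ)) (coclosedCompact ℝ) (nhds 0) := by
    rw [Filter.coclosedCompact_eq_cocompact]
    refine tendsto_const_nhds.congr' ?_
    have := (tendsto_norm_cocompact_atTop (E := ℝ)).eventually_ge_atTop (R + 1)
    filter_upwards [this] with x hx
    rw [Real.norm_eq_abs] at hx
    have : χ x = 0 := max_eq_left ((min_le_right _ _).trans (by linarith))
    simp [this]
  refine ⟨fun x => f x * (χ x : ℂ), isPolyLimit_of_onePoint hWpos hc hζ hr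
    (OnePoint.continuousMapMk ⟨_, hfχ⟩ 0 hlim), fun x => ?_⟩
  have e : f x - f x * (χ x : ℂ) = f x * ((1 - χ x : ℝ) : ℂ) := by push_cast; ring
  rw [e, norm_mul, Complex.norm_real, Real.norm_of_nonneg (by linarith [hχ1 x])]
  by_cases hx : |x| ≤ R
  · have : χ x = 1 := by
      have h1 : 1 ≤ R + 1 - |x| := by linarith
      simp [hχ, min_eq_left h1]
    rw [this, sub_self, mul_zero]
    exact mul_nonneg hε.le (hWpos x).le
  · have h1 := hR (x := x) (by simpa using hx)
    rw [div_lt_iff₀ (hWpos x)] at h1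
    exact (mul_le_of_le_one_right (norm_nonneg _) (by linarith [hχ0 x])).trans h1.le

end Growth

/-- Mergelyan's criterion: for a continuous weight `W` dominating all polynomials,
density of the polynomials in `C₀(W)` is equivalent to `𝔪(z₀) = ∞` for one nonreal
`z₀`, and also to `𝔪(z) = ∞` for all nonreal `z`. -/
theorem stmt0 (W : ℝ → ℝ) (hWc : Continuous W) (hWpos : ∀ x, 0 < W x)
    (hWgrow : ∀ n : ℕ, Tendsto (fun x : ℝ => x ^ n / W x) (cocompact ℝ) (nhds 0)) :
    (PolysDense W ↔ ∃ z₀ : ℂ, z₀.im ≠ 0 ∧ hallMajorant W z₀ = ⊤) ∧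
    ((∃ z₀ : ℂ, z₀.im ≠ 0 ∧ hallMajorant W z₀ = ⊤) ↔
      (∀ z : ℂ, z.im ≠ 0 → hallMajorant W z = ⊤)) := by
  have hup : ∀ z₀ : ℂ, z₀.im ≠ 0 → hallMajorant W z₀ = ⊤ → PolysDense W := fun _ hz h =>
    polysDense_of_hallMajorant_eq_top hWc hWpos hWgrow hz h
  have hdown : PolysDense W → ∀ z : ℂ, z.im ≠ 0 → hallMajorant W z = ⊤ := fun h _ hz =>
    hallMajorant_eq_top_of_polysDense hWc hWpos hWgrow h hz
  have hI : Complex.I.im ≠ 0 := by simp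
  exact ⟨⟨fun h => ⟨Complex.I, hI, hdown h _ hI⟩, fun ⟨z₀, hz, h⟩ => hup z₀ hz h⟩,
    ⟨fun ⟨z₀, hz, h⟩ => hdown (hup z₀ hz h), fun h => ⟨Complex.I, hI, h _ hI⟩⟩⟩
end

section
/- Let W : ℝ → (0,∞) be a continuous weight with lim_{|x|→∞} x^n/W(x) = 0 for every n ∈ ℕ. Then the polynomials ℂ[z] are dense in C₀(W) if and only if sup{∫_ℝ log|P(x)|/(1+x²) dx : P a polynomial with complex coefficients, ‖P‖_{C₀(W)} ≤ 1} = ∞. -/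
open Filter Polynomial MeasureTheory
open scoped ENNReal NNReal

/-- The substitution `x = tan φ`, `w = exp (2 i φ)` identifies the normalized measure
`dx / (1 + x ^ 2)` on `ℝ` with half of the arc length on the circle. -/
lemma integral_comp_tan_eq_circleAverage {g : ℝ → ℝ} {G : ℂ → ℝ} (hG : CircleIntegrable G 0 1)
    (h : ∀ᵐ φ ∂(volume.restrict (Set.Ioo (-(Real.pi / 2)) (Real.pi / 2))),
      g (Real.tan φ) = G (circleMap 0 1 (2 * φ))) :
    Integrable (fun x => g x / (1 + x ^ 2)) ∧
      ∫ x, g x / (1 + x ^ 2) = Real.pi * Real.circleAverage G 0 1 := by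
  have hpi := Real.pi_pos
  have hper : Function.Periodic (fun θ => G (circleMap 0 1 θ)) (2 * Real.pi) :=
    fun θ => by simp [periodic_circleMap 0 1 θ]
  have hI : IntegrableOn (fun φ => G (circleMap 0 1 (2 * φ)))
      (Set.Ioo (-(Real.pi / 2)) (Real.pi / 2)) := by
    have h1 : IntervalIntegrable (fun θ => G (circleMap 0 1 θ)) volume (-Real.pi) Real.pi :=
      hper.intervalIntegrable₀ (by positivity) hG _ _
    have h2 := h1.comp_mul_left (c := 2)
    rw [show -Real.pi / 2 = -(Real.pi / 2) by ring] at h2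
    exact (intervalIntegrable_iff_integrableOn_Ioo_of_le (by linarith)).1 h2
  have hE : ∫ φ in Set.Ioo (-(Real.pi / 2)) (Real.pi / 2), G (circleMap 0 1 (2 * φ)) =
      Real.pi * Real.circleAverage G 0 1 := by
    rw [← integral_Ioc_eq_integral_Ioo, ← intervalIntegral.integral_of_le (by linarith),
      intervalIntegral.integral_comp_mul_left (fun θ => G (circleMap 0 1 θ)) two_ne_zero,
      Real.circleAverage_def]
    have := hper.intervalIntegral_add_eq (-Real.pi) 0
    rw [show 2 * -(Real.pi / 2) = -Real.pi by ring,
      show 2 * (Real.pi / 2) = -Real.pi + 2 * Real.pi by ring, this]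
    simp only [zero_add, smul_eq_mul]
    field_simp
  have hd : ∀ x ∈ Set.Ioo (-(Real.pi / 2)) (Real.pi / 2),
      HasDerivWithinAt Real.tan (1 / Real.cos x ^ 2) (Set.Ioo (-(Real.pi / 2)) (Real.pi / 2)) x :=
    fun x hx => (Real.hasDerivAt_tan_of_mem_Ioo hx).hasDerivWithinAt
  have hinj := Real.injOn_tan
  have hae : (fun φ => |1 / Real.cos φ ^ 2| • (g (Real.tan φ) / (1 + Real.tan φ ^ 2)))
      =ᵐ[volume.restrict (Set.Ioo (-(Real.pi / 2)) (Real.pi / 2))]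
      fun φ => G (circleMap 0 1 (2 * φ)) := by
    filter_upwards [h, ae_restrict_mem measurableSet_Ioo] with φ h1 h2
    have hc := Real.cos_pos_of_mem_Ioo h2
    rw [h1, ← Real.inv_one_add_tan_sq hc.ne', abs_of_nonneg (by positivity), smul_eq_mul]
    have : 0 < 1 + Real.tan φ ^ 2 := by positivity
    field_simp
  constructor
  · rw [← integrableOn_univ, ← Real.image_tan_Ioo,
      integrableOn_image_iff_integrableOn_abs_deriv_smul measurableSet_Ioo hd hinj]
    exact hI.congr hae.symm
  · rw [← setIntegral_univ, ← Real.image_tan_Ioo,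
      integral_image_eq_integral_abs_deriv_smul measurableSet_Ioo hd hinj, ← hE]
    exact integral_congr_ae hae

/-- Poisson's formula at the point `i` for the logarithm of a linear factor. -/
lemma integral_log_norm_sub_of_im_nonneg {a : ℂ} (ha : 0 ≤ a.im) :
    Integrable (fun x : ℝ => Real.log ‖(x : ℂ) - a‖ / (1 + x ^ 2)) ∧
      ∫ x : ℝ, Real.log ‖(x : ℂ) - a‖ / (1 + x ^ 2) = Real.pi * Real.log ‖a + Complex.I‖ := by
  have hne : 1 - Complex.I * a ≠ 0 := by
    intro h
    have := congrArg Complex.re h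
    simp at this
    linarith
  have hnorm : ‖1 - Complex.I * a‖ = ‖a + Complex.I‖ := by
    rw [show 1 - Complex.I * a = -Complex.I * (a + Complex.I) by
      linear_combination Complex.I_mul_I]
    simp
  set b : ℂ := (1 + Complex.I * a) / (1 - Complex.I * a) with hb
  have hb1 : ‖b‖ ≤ 1 := by
    rw [hb, norm_div, div_le_one (norm_pos_iff.2 hne), ← sq_le_sq₀ (norm_nonneg _) (norm_nonneg _),
      ← Complex.normSq_eq_norm_sq, ← Complex.normSq_eq_norm_sq, Complex.normSq_apply,
      Complex.normSq_apply]
    simp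
    nlinarith
  have hlogInt : ∀ c : ℂ, CircleIntegrable (fun w => Real.log ‖w - c‖) 0 1 :=
    fun c => circleIntegrable_log_norm_sub_const 1
  have havg : ∀ c : ℂ, ‖c‖ ≤ 1 → Real.circleAverage (fun w => Real.log ‖w - c‖) 0 1 = 0 := by
    intro c hc
    rw [circleAverage_log_norm_sub_const_of_mem_closedBall (by simpa using hc), Real.log_one]
  have hconst := circleIntegrable_const (Real.log ‖a + Complex.I‖) (0 : ℂ) 1
  have key := integral_comp_tan_eq_circleAverage (g := fun x => Real.log ‖(x : ℂ) - a‖)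
    (G := ((fun _ => Real.log ‖a + Complex.I‖) + fun w => Real.log ‖w - b‖) -
      fun w => Real.log ‖w - (-1)‖) ((hconst.add (hlogInt b)).sub (hlogInt (-1))) ?_
  · refine ⟨key.1, key.2.trans ?_⟩
    rw [Real.circleAverage_sub (hconst.add (hlogInt b)) (hlogInt (-1)),
      Real.circleAverage_add hconst (hlogInt b), havg b hb1, havg (-1) (by simp),
      Real.circleAverage_const]
    simp
  · have h0 : ∀ᵐ φ : ℝ ∂(volume.restrict (Set.Ioo (-(Real.pi / 2)) (Real.pi / 2))),
        φ ≠ Real.arctan a.re :=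
      ae_restrict_of_ae (Measure.ae_ne volume _)
    filter_upwards [h0, ae_restrict_mem measurableSet_Ioo] with φ h1 h2
    have hc := Real.cos_pos_of_mem_Ioo h2
    have hxa : (Real.tan φ : ℂ) - a ≠ 0 := by
      intro h
      apply h1
      have := congrArg Complex.re (sub_eq_zero.1 h)
      rw [Complex.ofReal_re] at this
      rw [← this, Real.arctan_tan h2.1 h2.2]
    set e := Complex.exp (φ * Complex.I) with he
    have hcm : circleMap 0 1 (2 * φ) = e ^ 2 := by
      rw [circleMap, he, ← Complex.exp_nat_mul]
      push_cast
      simp [mul_assoc]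
    have he0 : e ≠ 0 := Complex.exp_ne_zero _
    have hcC : (2 : ℂ) * Real.cos φ = e + e⁻¹ := by
      rw [Complex.ofReal_cos, Complex.two_cos, he, ← Complex.exp_neg]; simp
    have hsC : (2 : ℂ) * Real.sin φ = (e⁻¹ - e) * Complex.I := by
      rw [Complex.ofReal_sin, Complex.two_sin, he, ← Complex.exp_neg]; simp
    have hc' : (Real.cos φ : ℂ) ≠ 0 := by exact_mod_cast hc.ne'
    have hw1 : e ^ 2 - (-1) = 2 * Real.cos φ * e := by
      rw [hcC]; field_simp; ring
    have hw1' : e ^ 2 - (-1) ≠ 0 := by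
      rw [hw1]; exact mul_ne_zero (mul_ne_zero two_ne_zero hc') he0
    have hident : (Real.tan φ - a) * (e ^ 2 - (-1)) =
        -Complex.I * ((1 - Complex.I * a) * (e ^ 2 - b)) := by
      have h3 : (1 - Complex.I * a) * b = 1 + Complex.I * a := mul_div_cancel₀ _ hne
      have h4 : (Real.tan φ : ℂ) * (2 * Real.cos φ * e) = 2 * Real.sin φ * e := by
        rw [Real.tan_eq_sin_div_cos, Complex.ofReal_div]; field_simp
      have h5 : (2 : ℂ) * Real.sin φ * e = (1 - e ^ 2) * Complex.I := by
        rw [hsC]; field_simp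
      rw [sub_mul, hw1, h4, ← hw1, h5, mul_sub (1 - Complex.I * a), h3]
      ring_nf
      simp
      ring
    have hn := congrArg norm hident
    rw [norm_mul, norm_mul, norm_mul] at hn
    simp only [norm_neg, Complex.norm_I, one_mul] at hn
    have hb0 : e ^ 2 - b ≠ 0 := by
      intro h
      rw [h, norm_zero, mul_zero] at hn
      exact mul_ne_zero (norm_ne_zero_iff.2 hxa) (norm_ne_zero_iff.2 hw1') hn
    have hl := congrArg Real.log hn
    rw [Real.log_mul (norm_ne_zero_iff.2 hxa) (norm_ne_zero_iff.2 hw1'),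
      Real.log_mul (norm_ne_zero_iff.2 hne) (norm_ne_zero_iff.2 hb0), hnorm] at hl
    simp only [Pi.sub_apply, Pi.add_apply, hcm]
    linarith

/-- The logarithmic integral of `P` is finite and is attained by Poisson's formula at `i` for some
polynomial `Q` with the same modulus as `P` on `ℝ`, obtained by reflecting zeros. -/
def HasOuterPart (P : ℂ[X]) : Prop :=
  P ≠ 0 ∧ Integrable (fun x : ℝ => Real.log ‖P.eval (x : ℂ)‖ / (1 + x ^ 2)) ∧
    ∃ Q : ℂ[X], (∀ x : ℝ, ‖Q.eval (x : ℂ)‖ = ‖P.eval (x : ℂ)‖) ∧ Q.eval Complex.I ≠ 0 ∧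
      ‖P.eval Complex.I‖ ≤ ‖Q.eval Complex.I‖ ∧
      ∫ x : ℝ, Real.log ‖P.eval (x : ℂ)‖ / (1 + x ^ 2) = Real.pi * Real.log ‖Q.eval Complex.I‖

lemma ae_eval_ofReal_ne_zero {P : ℂ[X]} (hP : P ≠ 0) : ∀ᵐ x : ℝ, P.eval (x : ℂ) ≠ 0 := by
  have hfin : {x : ℝ | P.eval (x : ℂ) = 0}.Finite := by
    have : {z : ℂ | P.eval z = 0}.Finite := by
      refine (P.roots.toFinset.finite_toSet).subset fun z hz => ?_
      simpa [hP] using hz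
    exact this.preimage Complex.ofReal_injective.injOn
  rw [ae_iff]
  simpa using hfin.measure_zero volume

lemma HasOuterPart.mul {P Q : ℂ[X]} (hP : HasOuterPart P) (hQ : HasOuterPart Q) :
    HasOuterPart (P * Q) := by
  obtain ⟨hP0, hPi, P', hP1, hP2, hP3, hP4⟩ := hP
  obtain ⟨hQ0, hQi, Q', hQ1, hQ2, hQ3, hQ4⟩ := hQ
  have hae : (fun x : ℝ => Real.log ‖P.eval (x : ℂ)‖ / (1 + x ^ 2) +
      Real.log ‖Q.eval (x : ℂ)‖ / (1 + x ^ 2)) =ᵐ[volume]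
      fun x : ℝ => Real.log ‖(P * Q).eval (x : ℂ)‖ / (1 + x ^ 2) := by
    filter_upwards [ae_eval_ofReal_ne_zero hP0, ae_eval_ofReal_ne_zero hQ0] with x h1 h2
    rw [eval_mul, norm_mul, Real.log_mul (norm_ne_zero_iff.2 h1) (norm_ne_zero_iff.2 h2), add_div]
  refine ⟨mul_ne_zero hP0 hQ0, (hPi.add hQi).congr hae, P' * Q', fun x => ?_, ?_, ?_, ?_⟩
  · simp [hP1, hQ1]
  · simp [hP2, hQ2]
  · simp only [eval_mul, norm_mul]
    gcongr
  · rw [← integral_congr_ae hae, integral_add hPi hQi, hP4, hQ4, eval_mul, norm_mul,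
      Real.log_mul (norm_ne_zero_iff.2 hP2) (norm_ne_zero_iff.2 hQ2), mul_add]

lemma hasOuterPart_C {c : ℂ} (hc : c ≠ 0) : HasOuterPart (C c) := by
  refine ⟨by simpa using hc, ?_, C c, by simp, by simpa using hc, le_rfl, ?_⟩
  · simp only [eval_C, div_eq_mul_inv]
    exact integrable_inv_one_add_sq.const_mul _
  · simp only [eval_C, div_eq_mul_inv]
    rw [integral_const_mul, integral_univ_inv_one_add_sq, mul_comm]

lemma norm_ofReal_sub_conj (x : ℝ) (a : ℂ) :
    ‖(x : ℂ) - (starRingEnd ℂ) a‖ = ‖(x : ℂ) - a‖ := by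
  rw [← Complex.norm_conj, map_sub, Complex.conj_conj, Complex.conj_ofReal]

lemma norm_I_sub_conj (a : ℂ) :
    ‖Complex.I - (starRingEnd ℂ) a‖ = ‖a + Complex.I‖ := by
  rw [← Complex.norm_conj, map_sub, Complex.conj_conj, Complex.conj_I, ← norm_neg]
  congr 1; ring

lemma norm_I_sub_le {a : ℂ} (ha : 0 ≤ a.im) : ‖Complex.I - a‖ ≤ ‖a + Complex.I‖ := by
  rw [← sq_le_sq₀ (norm_nonneg _) (norm_nonneg _),
    ← Complex.normSq_eq_norm_sq, ← Complex.normSq_eq_norm_sq, Complex.normSq_apply,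
    Complex.normSq_apply]
  simp
  nlinarith

lemma add_I_ne_zero {a : ℂ} (ha : 0 ≤ a.im) : a + Complex.I ≠ 0 := by
  intro h
  have := congrArg Complex.im h
  simp at this
  linarith

lemma hasOuterPart_X_sub_C (a : ℂ) : HasOuterPart (X - C a) := by
  rcases le_total 0 a.im with ha | ha
  · have h := integral_log_norm_sub_of_im_nonneg ha
    refine ⟨X_sub_C_ne_zero a, by simpa using h.1, X - C ((starRingEnd ℂ) a), ?_, ?_, ?_, ?_⟩
    · simp [norm_ofReal_sub_conj]
    · rw [← norm_ne_zero_iff]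
      simpa [norm_I_sub_conj] using add_I_ne_zero ha
    · simpa [norm_I_sub_conj] using norm_I_sub_le ha
    · simpa [norm_I_sub_conj] using h.2
  · have ha' : 0 ≤ ((starRingEnd ℂ) a).im := by simpa using ha
    have h := integral_log_norm_sub_of_im_nonneg ha'
    have hI : ‖Complex.I - a‖ = ‖(starRingEnd ℂ) a + Complex.I‖ := by
      rw [← norm_I_sub_conj, Complex.conj_conj]
    simp only [norm_ofReal_sub_conj, ← hI] at h
    refine ⟨X_sub_C_ne_zero a, by simpa using h.1, X - C a, by simp, ?_, le_rfl, ?_⟩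
    · rw [← norm_ne_zero_iff]
      simpa [hI] using add_I_ne_zero ha'
    · simpa using h.2

lemma hasOuterPart {P : ℂ[X]} (hP : P ≠ 0) : HasOuterPart P := by
  rw [(IsAlgClosed.splits P).eq_prod_roots]
  refine (hasOuterPart_C (leadingCoeff_ne_zero.2 hP)).mul ?_
  refine Multiset.prod_induction HasOuterPart _ (fun _ _ => HasOuterPart.mul) ?_ ?_
  · simpa using hasOuterPart_C one_ne_zero
  · simp only [Multiset.mem_map]
    rintro _ ⟨a, -, rfl⟩
    exact hasOuterPart_X_sub_C a

lemma exists_pow_le_mul_weight {W : ℝ → ℝ} (hWc : Continuous W) (hWpos : ∀ x, 0 < W x)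
    (hWgrow : ∀ n : ℕ, Tendsto (fun x : ℝ => x ^ n / W x) (cocompact ℝ) (nhds 0)) (n : ℕ) :
    ∃ K : ℝ, 0 < K ∧ ∀ x, |x| ^ n ≤ K * W x := by
  let f : ZeroAtInftyContinuousMap ℝ ℝ :=
    ⟨⟨fun x => x ^ n / W x, (continuous_pow n).div hWc fun x => (hWpos x).ne'⟩, hWgrow n⟩
  refine ⟨‖f.toBCF‖ + 1, by positivity, fun x => ?_⟩
  have h : ‖x ^ n / W x‖ ≤ ‖f.toBCF‖ := f.toBCF.norm_coe_le_norm x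
  rw [norm_div, norm_pow, Real.norm_eq_abs, Real.norm_of_nonneg (hWpos x).le,
    div_le_iff₀ (hWpos x)] at h
  nlinarith [hWpos x]

lemma exists_norm_eval_le_mul_weight_s2 {W : ℝ → ℝ}
    (hW : ∀ n : ℕ, ∃ K : ℝ, 0 < K ∧ ∀ x, |x| ^ n ≤ K * W x) (P : ℂ[X]) :
    ∃ K : ℝ, ∀ x : ℝ, ‖P.eval (x : ℂ)‖ ≤ K * W x := by
  induction P using Polynomial.induction_on' with
  | add P Q hP hQ =>
    obtain ⟨K, hK⟩ := hP
    obtain ⟨L, hL⟩ := hQ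
    refine ⟨K + L, fun x => ?_⟩
    rw [eval_add, add_mul]
    exact (norm_add_le _ _).trans (add_le_add (hK x) (hL x))
  | monomial n c =>
    obtain ⟨K, -, hK⟩ := hW n
    refine ⟨‖c‖ * K, fun x => ?_⟩
    rw [eval_monomial, norm_mul, norm_pow, Complex.norm_real, Real.norm_eq_abs, mul_assoc]
    exact mul_le_mul_of_nonneg_left (hK x) (norm_nonneg c)

/-- The function `f` is a limit of polynomials in the seminorm `sup |f| / W`. -/
def IsPolynomialLimit (W : ℝ → ℝ) (f : ℝ → ℂ) : Prop :=
  ∀ ε : ℝ, 0 < ε → ∃ P : ℂ[X], ∀ x : ℝ, ‖f x - P.eval (x : ℂ)‖ ≤ ε * W x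

lemma isPolynomialLimit_eval {W : ℝ → ℝ} (hWpos : ∀ x, 0 < W x) (P : ℂ[X]) :
    IsPolynomialLimit W fun x : ℝ => P.eval (x : ℂ) :=
  fun ε hε => ⟨P, fun x => by simpa using (mul_pos hε (hWpos x)).le⟩

namespace IsPolynomialLimit

variable {W : ℝ → ℝ} {f g : ℝ → ℂ}

lemma add (hf : IsPolynomialLimit W f) (hg : IsPolynomialLimit W g) :
    IsPolynomialLimit W fun x => f x + g x := by
  intro ε hε
  obtain ⟨P, hP⟩ := hf (ε / 2) (by positivity)
  obtain ⟨Q, hQ⟩ := hg (ε / 2) (by positivity)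
  refine ⟨P + Q, fun x => ?_⟩
  rw [eval_add, show f x + g x - (P.eval (x : ℂ) + Q.eval (x : ℂ)) =
    (f x - P.eval (x : ℂ)) + (g x - Q.eval (x : ℂ)) by ring]
  linarith [norm_add_le (f x - P.eval (x : ℂ)) (g x - Q.eval (x : ℂ)), hP x, hQ x]

lemma mul_const (hWpos : ∀ x, 0 < W x) (hf : IsPolynomialLimit W f) (c : ℂ) :
    IsPolynomialLimit W fun x => f x * c := by
  intro ε hε
  obtain ⟨P, hP⟩ := hf (ε / (‖c‖ + 1)) (by positivity)
  refine ⟨P * C c, fun x => ?_⟩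
  rw [eval_mul, eval_C, ← sub_mul, norm_mul]
  have := hWpos x
  calc ‖f x - P.eval (x : ℂ)‖ * ‖c‖ ≤ ε / (‖c‖ + 1) * W x * (‖c‖ + 1) :=
        mul_le_mul (hP x) (by linarith) (norm_nonneg _) (by positivity)
    _ = ε * W x := by field_simp

lemma conj (hf : IsPolynomialLimit W f) :
    IsPolynomialLimit W fun x => (starRingEnd ℂ) (f x) := by
  intro ε hε
  obtain ⟨P, hP⟩ := hf ε hε
  refine ⟨P.map (starRingEnd ℂ), fun x => ?_⟩
  have : (P.map (starRingEnd ℂ)).eval (x : ℂ) = (starRingEnd ℂ) (P.eval (x : ℂ)) := by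
    rw [eval_map, ← eval₂_at_apply, Complex.conj_ofReal]
  rw [this, ← map_sub, Complex.norm_conj]
  exact hP x

lemma mul_inv_sub (hWpos : ∀ x, 0 < W x) {a : ℂ}
    (ha : ∀ x : ℝ, ‖((x : ℂ) - a)⁻¹‖ ≤ 1) (ha0 : ∀ x : ℝ, (x : ℂ) - a ≠ 0)
    (hf : IsPolynomialLimit W f) (hg : IsPolynomialLimit W fun x : ℝ => ((x : ℂ) - a)⁻¹) :
    IsPolynomialLimit W fun x => f x * ((x : ℂ) - a)⁻¹ := by
  intro ε hε
  obtain ⟨P, hP⟩ := hf (ε / 2) (by positivity)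
  obtain ⟨R, hR⟩ := hg.mul_const hWpos (P.eval a) (ε / 2) (by positivity)
  refine ⟨P /ₘ (X - C a) + R, fun x => ?_⟩
  have hdiv : P.eval (x : ℂ) = P.eval a + (x - a) * (P /ₘ (X - C a)).eval (x : ℂ) := by
    conv_lhs => rw [← modByMonic_add_div P (X - C a), modByMonic_X_sub_C_eq_C_eval]
    simp
  have hsplit : f x * ((x : ℂ) - a)⁻¹ - (P /ₘ (X - C a) + R).eval (x : ℂ) =
      (f x - P.eval (x : ℂ)) * ((x : ℂ) - a)⁻¹ +
        (((x : ℂ) - a)⁻¹ * P.eval a - R.eval (x : ℂ)) := by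
    rw [hdiv, eval_add]
    have := ha0 x
    field_simp
    ring
  rw [hsplit]
  have h1 : ‖(f x - P.eval (x : ℂ)) * ((x : ℂ) - a)⁻¹‖ ≤ ε / 2 * W x := by
    rw [norm_mul]
    exact (mul_le_of_le_one_right (norm_nonneg _) (ha x)).trans (hP x)
  linarith [norm_add_le ((f x - P.eval (x : ℂ)) * ((x : ℂ) - a)⁻¹)
    (((x : ℂ) - a)⁻¹ * P.eval a - R.eval (x : ℂ)), hR x]

lemma exists_norm_le (hW : ∀ n : ℕ, ∃ K : ℝ, 0 < K ∧ ∀ x, |x| ^ n ≤ K * W x)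
    (hf : IsPolynomialLimit W f) : ∃ K : ℝ, ∀ x, ‖f x‖ ≤ K * W x := by
  obtain ⟨P, hP⟩ := hf 1 one_pos
  obtain ⟨K, hK⟩ := exists_norm_eval_le_mul_weight_s2 hW P
  refine ⟨1 + K, fun x => ?_⟩
  rw [add_mul]
  calc ‖f x‖ = ‖(f x - P.eval (x : ℂ)) + P.eval (x : ℂ)‖ := by rw [sub_add_cancel]
    _ ≤ _ := (norm_add_le _ _).trans (add_le_add (hP x) (hK x))

end IsPolynomialLimit

lemma ofReal_sub_I_ne_zero (x : ℝ) : (x : ℂ) - Complex.I ≠ 0 := by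
  intro h
  simpa using congrArg Complex.im h

lemma normSq_ofReal_sub_I (x : ℝ) : Complex.normSq ((x : ℂ) - Complex.I) = 1 + x ^ 2 := by
  rw [Complex.normSq_apply]
  simp
  ring

lemma norm_inv_ofReal_sub_I_le (x : ℝ) : ‖((x : ℂ) - Complex.I)⁻¹‖ ≤ 1 := by
  rw [norm_inv, inv_le_one_iff₀]
  right
  rw [← one_le_sq_iff₀ (norm_nonneg _), ← Complex.normSq_eq_norm_sq, normSq_ofReal_sub_I]
  nlinarith [sq_nonneg x]

lemma conj_inv_ofReal_sub_I (x : ℝ) :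
    (starRingEnd ℂ) ((x : ℂ) - Complex.I)⁻¹ = ((x : ℂ) - -Complex.I)⁻¹ := by
  rw [map_inv₀, map_sub, Complex.conj_ofReal, Complex.conj_I]

/-- The map `x ↦ 1 / (x - i)` into the closed unit disc. -/
noncomputable def invSubI (x : ℝ) : Metric.closedBall (0 : ℂ) 1 :=
  ⟨((x : ℂ) - Complex.I)⁻¹, by simpa using norm_inv_ofReal_sub_I_le x⟩

lemma IsPolynomialLimit.mul_comp_invSubI {W : ℝ → ℝ} (hWpos : ∀ x, 0 < W x)
    (hW : ∀ n : ℕ, ∃ K : ℝ, 0 < K ∧ ∀ x, |x| ^ n ≤ K * W x)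
    (hg : IsPolynomialLimit W fun x : ℝ => ((x : ℂ) - Complex.I)⁻¹)
    (h : C(Metric.closedBall (0 : ℂ) 1, ℂ)) :
    ∀ f : ℝ → ℂ, IsPolynomialLimit W f → IsPolynomialLimit W fun x => f x * h (invSubI x) := by
  have : CompactSpace (Metric.closedBall (0 : ℂ) 1) :=
    isCompact_iff_compactSpace.1 (isCompact_closedBall 0 1)
  induction h using ContinuousMap.induction_on_of_compact with
  | const r => exact fun f hf => hf.mul_const hWpos r
  | id =>
    exact fun f hf =>
      hf.mul_inv_sub hWpos norm_inv_ofReal_sub_I_le ofReal_sub_I_ne_zero hg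
  | star_id =>
    intro f hf
    have hg' := hg.conj
    have hn : ∀ x : ℝ, ‖((x : ℂ) - -Complex.I)⁻¹‖ ≤ 1 := fun x => by
      rw [← conj_inv_ofReal_sub_I, Complex.norm_conj]
      exact norm_inv_ofReal_sub_I_le x
    have h0 : ∀ x : ℝ, (x : ℂ) - -Complex.I ≠ 0 := fun x h => by
      simpa using congrArg Complex.im h
    simp only [conj_inv_ofReal_sub_I] at hg'
    have key := hf.mul_inv_sub hWpos hn h0 hg'
    simp only [← conj_inv_ofReal_sub_I] at key
    exact key
  | add u v hu hv =>
    intro f hf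
    simpa [mul_add] using (hu f hf).add (hv f hf)
  | mul u v hu hv =>
    intro f hf
    simpa [mul_assoc] using hv _ (hu f hf)
  | frequently u hu =>
    intro f hf ε hε
    obtain ⟨K, hK⟩ := hf.exists_norm_le hW
    have hK0 : 0 ≤ K :=
      nonneg_of_mul_nonneg_left ((norm_nonneg _).trans (hK 0)) (hWpos 0)
    obtain ⟨v, hv, hvu⟩ := (hu.and_eventually
      (Metric.ball_mem_nhds u (show 0 < ε / (2 * (K + 1)) by positivity))).exists
    obtain ⟨P, hP⟩ := hv f hf (ε / 2) (by positivity)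
    refine ⟨P, fun x => ?_⟩
    have h1 : ‖u (invSubI x) - v (invSubI x)‖ ≤ ε / (2 * (K + 1)) := by
      rw [← dist_eq_norm, dist_comm]
      exact (ContinuousMap.dist_apply_le_dist _).trans (Metric.mem_ball.1 hvu).le
    have h2 : ‖f x * (u (invSubI x) - v (invSubI x))‖ ≤ ε / 2 * W x := by
      rw [norm_mul]
      have := hWpos x
      calc ‖f x‖ * ‖u (invSubI x) - v (invSubI x)‖
          ≤ (K + 1) * W x * (ε / (2 * (K + 1))) :=
            mul_le_mul ((hK x).trans (by nlinarith)) h1 (norm_nonneg _) (by positivity)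
        _ = ε / 2 * W x := by field_simp
    calc ‖f x * u (invSubI x) - P.eval (x : ℂ)‖
        = ‖f x * (u (invSubI x) - v (invSubI x)) +
            (f x * v (invSubI x) - P.eval (x : ℂ))‖ := by congr 1; ring
      _ ≤ ε / 2 * W x + ε / 2 * W x := (norm_add_le _ _).trans (add_le_add h2 (hP x))
      _ = ε * W x := by ring

/-- If `1 / (x - i)` is a limit of polynomials, then polynomials are dense. -/
lemma polysDense_of_isPolynomialLimit {W : ℝ → ℝ} (hWpos : ∀ x, 0 < W x)
    (hW : ∀ n : ℕ, ∃ K : ℝ, 0 < K ∧ ∀ x, |x| ^ n ≤ K * W x)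
    (hg : IsPolynomialLimit W fun x : ℝ => ((x : ℂ) - Complex.I)⁻¹) : PolysDense W := by
  intro f hf ε hε
  obtain ⟨hfc, hft⟩ := hf
  rw [← Metric.cobounded_eq_cocompact] at hft
  obtain ⟨r, -, hr⟩ := hasBasis_cobounded_norm.eventually_iff.1
    (hft.eventually (gt_mem_nhds (show 0 < ε / 2 by positivity)))
  set δ : ℝ := 1 / (2 * (1 + r ^ 2)) with hδ
  have hδ0 : 0 < δ := by positivity
  let χ : ℂ → ℝ := fun w => max 0 (min 1 (Complex.normSq w / δ - 1))
  let F : C(Metric.closedBall (0 : ℂ) 1, ℂ) :=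
    ⟨fun w => (χ w : ℂ) * f ((w : ℂ).re / max (Complex.normSq w) δ), by
      have hne : ∀ w : ℂ, max (Complex.normSq w) δ ≠ 0 := fun w =>
        (lt_max_of_lt_right hδ0).ne'
      have := Complex.continuous_normSq
      have hχ : Continuous χ := by fun_prop
      have hq : Continuous fun w : ℂ => w.re / max (Complex.normSq w) δ :=
        Complex.continuous_re.div (this.max continuous_const) hne
      exact (((Complex.continuous_ofReal.comp hχ).mul (hfc.comp hq)).comp
        continuous_subtype_val)⟩
  obtain ⟨P, hP⟩ := IsPolynomialLimit.mul_comp_invSubI hWpos hW hg F _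
    (isPolynomialLimit_eval hWpos 1) (ε / 2) (by positivity)
  refine ⟨P, fun x => ?_⟩
  set w : ℂ := ((x : ℂ) - Complex.I)⁻¹ with hw
  have hx : 0 < 1 + x ^ 2 := by positivity
  have hnw : Complex.normSq w = 1 / (1 + x ^ 2) := by
    rw [hw, map_inv₀, normSq_ofReal_sub_I, one_div]
  have hrew : w.re = x / (1 + x ^ 2) := by
    rw [hw, Complex.inv_re, normSq_ofReal_sub_I]
    simp
  have hF : F (invSubI x) = (χ w : ℂ) * f x := by
    change (χ w : ℂ) * f (w.re / max (Complex.normSq w) δ) = _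
    rcases le_total δ (Complex.normSq w) with h | h
    · rw [max_eq_left h, hrew, hnw]
      congr 2
      field_simp
    · have : χ w = 0 := by
        refine max_eq_left ((min_le_right _ _).trans ?_)
        rw [sub_nonpos, div_le_one hδ0]
        exact h
      simp [this]
  have hχ0 : 0 ≤ χ w := le_max_left _ _
  have hχ1 : χ w ≤ 1 := max_le zero_le_one (min_le_left _ _)
  have hmain : ‖f x - F (invSubI x)‖ ≤ ε / 2 * W x := by
    have he : f x - F (invSubI x) = ((1 - χ w : ℝ) : ℂ) * f x := by
      rw [hF]; push_cast; ring
    rw [he, norm_mul, Complex.norm_real, Real.norm_of_nonneg (by linarith)]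
    rcases le_total r ‖x‖ with h | h
    · have h2 := hr h
      rw [div_lt_iff₀ (hWpos x)] at h2
      nlinarith [norm_nonneg (f x)]
    · have h3 : χ w = 1 := by
        have hxr : x ^ 2 ≤ r ^ 2 := by
          rw [← sq_abs x]
          exact pow_le_pow_left₀ (abs_nonneg x) h 2
        have h4 : 2 ≤ Complex.normSq w / δ := by
          rw [hnw, hδ, le_div_iff₀ (by positivity)]
          have : (1 + r ^ 2)⁻¹ ≤ (1 + x ^ 2)⁻¹ := inv_anti₀ hx (by linarith)
          calc 2 * (1 / (2 * (1 + r ^ 2))) = (1 + r ^ 2)⁻¹ := by field_simp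
            _ ≤ 1 / (1 + x ^ 2) := by rwa [one_div]
        change max 0 (min 1 (Complex.normSq w / δ - 1)) = 1
        rw [min_eq_left (by linarith), max_eq_right zero_le_one]
      rw [h3]
      have := hWpos x
      simp
      positivity
  have h5 := hP x
  simp only [eval_one, one_mul] at h5
  calc ‖f x - P.eval (x : ℂ)‖
      = ‖(f x - F (invSubI x)) + (F (invSubI x) - P.eval (x : ℂ))‖ := by
        rw [sub_add_sub_cancel]
    _ ≤ ε * W x := by
        linarith [norm_add_le (f x - F (invSubI x)) (F (invSubI x) - P.eval (x : ℂ))]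

/-- Polynomials bounded by `W` with a large logarithmic integral approximate `1 / (x - i)`. -/
lemma isPolynomialLimit_inv_sub_I {W : ℝ → ℝ}
    (h : ∀ K : ℝ, ∃ P : ℂ[X], (∀ x : ℝ, ‖P.eval (x : ℂ)‖ ≤ W x) ∧
      K ≤ ∫ x : ℝ, Real.log ‖P.eval (x : ℂ)‖ / (1 + x ^ 2)) :
    IsPolynomialLimit W fun x : ℝ => ((x : ℂ) - Complex.I)⁻¹ := by
  intro ε hε
  obtain ⟨P, hPW, hP⟩ := h (max 1 (Real.pi * Real.log ε⁻¹))
  have hP0 : P ≠ 0 := by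
    rintro rfl
    simp at hP
    linarith [hP.1]
  obtain ⟨-, -, Q, hQP, hQ0, -, hQ⟩ := hasOuterPart hP0
  have hlog : Real.log ε⁻¹ ≤ Real.log ‖Q.eval Complex.I‖ := by
    have := (le_max_right _ _).trans hP
    rw [hQ] at this
    exact le_of_mul_le_mul_left this Real.pi_pos
  have hnorm := (Real.log_le_log_iff (by positivity) (norm_pos_iff.2 hQ0)).1 hlog
  set c := Q.eval Complex.I with hc
  refine ⟨-C c⁻¹ * (Q /ₘ (X - C Complex.I)), fun x => ?_⟩
  have hx := ofReal_sub_I_ne_zero x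
  have hdiv : Q.eval (x : ℂ) =
      c + (x - Complex.I) * (Q /ₘ (X - C Complex.I)).eval (x : ℂ) := by
    conv_lhs => rw [← modByMonic_add_div Q (X - C Complex.I), modByMonic_X_sub_C_eq_C_eval]
    simp [hc]
  have he : ((x : ℂ) - Complex.I)⁻¹ - (-C c⁻¹ * (Q /ₘ (X - C Complex.I))).eval (x : ℂ) =
      c⁻¹ * Q.eval (x : ℂ) * ((x : ℂ) - Complex.I)⁻¹ := by
    rw [hdiv]
    simp only [eval_mul, eval_neg, eval_C]
    field_simp
    ring
  rw [he, norm_mul, norm_mul, hQP, norm_inv]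
  have h1 : ‖c‖⁻¹ ≤ ε := inv_le_of_inv_le₀ hε hnorm
  calc ‖c‖⁻¹ * ‖P.eval (x : ℂ)‖ * ‖((x : ℂ) - Complex.I)⁻¹‖
      ≤ ‖c‖⁻¹ * ‖P.eval (x : ℂ)‖ :=
        mul_le_of_le_one_right (by positivity) (norm_inv_ofReal_sub_I_le x)
    _ ≤ ε * W x := mul_le_mul h1 (hPW x) (norm_nonneg _) hε.le

lemma abs_log_eq_two_mul_posLog_sub_log (t : ℝ) :
    |Real.log t| = 2 * Real.posLog t - Real.log t := by
  rw [Real.posLog_apply]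
  rcases le_total 0 (Real.log t) with h | h
  · rw [max_eq_right h, abs_of_nonneg h]; ring
  · rw [max_eq_left h, abs_of_nonpos h]; ring

lemma integrable_posLog_norm_eval (P : ℂ[X]) :
    Integrable fun x : ℝ => Real.posLog ‖P.eval (x : ℂ)‖ / (1 + x ^ 2) := by
  rcases eq_or_ne P 0 with rfl | hP
  · simp
  refine (hasOuterPart hP).2.1.mono ?_ (ae_of_all _ fun x => ?_)
  · have hc : Continuous fun x : ℝ => ‖P.eval (x : ℂ)‖ := by fun_prop
    exact ((Real.continuous_posLog.comp hc).div (by fun_prop)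
      fun x => by positivity).aestronglyMeasurable
  · rw [norm_div, norm_div]
    gcongr
    rw [Real.norm_of_nonneg Real.posLog_nonneg, Real.norm_eq_abs, Real.posLog_apply]
    exact max_le (abs_nonneg _) (le_abs_self _)

/-- Averaging over rotations: adding a suitable unimodular constant to a polynomial replaces its
logarithmic integral by that of `log⁺`. -/
lemma integral_posLog_norm_eval_le {P : ℂ[X]} {K : ℝ}
    (h : ∀ θ : ℝ, ∫ x : ℝ, Real.log ‖P.eval (x : ℂ) + circleMap 0 1 θ‖ / (1 + x ^ 2) ≤ K) :
    ∫ x : ℝ, Real.posLog ‖P.eval (x : ℂ)‖ / (1 + x ^ 2) ≤ K := by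
  have hpi := Real.pi_pos
  have hpi2 : (0 : ℝ) ≤ 2 * Real.pi := by positivity
  set ν : Measure ℝ := volume.restrict (Set.Ioc 0 (2 * Real.pi)) with hν
  have hlogint : ∀ p : ℂ, Integrable (fun θ => Real.log ‖p + circleMap 0 1 θ‖) ν := by
    intro p
    have := circleIntegrable_log_norm_sub_const (a := -p) (c := 0) 1
    rw [CircleIntegrable, intervalIntegrable_iff_integrableOn_Ioc_of_le hpi2] at this
    simp only [sub_neg_eq_add] at this
    simp only [add_comm p]
    exact this
  have hlogval : ∀ p : ℂ, ∫ θ, Real.log ‖p + circleMap 0 1 θ‖ ∂ν =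
      2 * Real.pi * Real.posLog ‖p‖ := by
    intro p
    have := circleAverage_log_norm_sub_const_eq_posLog (a := -p)
    rw [Real.circleAverage_def, intervalIntegral.integral_of_le hpi2, smul_eq_mul,
      inv_mul_eq_iff_eq_mul₀ (by positivity), norm_neg] at this
    rw [← this]
    simp only [sub_neg_eq_add, add_comm p, hν]
  have hνvol : ν.real Set.univ = 2 * Real.pi := by
    simp [hν, hpi.le]
  let F : ℝ → ℝ → ℝ := fun x θ => Real.log ‖P.eval (x : ℂ) + circleMap 0 1 θ‖ / (1 + x ^ 2)
  have hFmeas : AEStronglyMeasurable (Function.uncurry F) (volume.prod ν) := by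
    have h1 : Continuous fun z : ℝ × ℝ => ‖P.eval (z.1 : ℂ) + circleMap 0 1 z.2‖ := by fun_prop
    have h2 : Continuous fun z : ℝ × ℝ => 1 + z.1 ^ 2 := by fun_prop
    exact ((Real.measurable_log.comp h1.measurable).div h2.measurable).aestronglyMeasurable
  have hFint : Integrable (Function.uncurry F) (volume.prod ν) := by
    rw [integrable_prod_iff hFmeas]
    refine ⟨ae_of_all _ fun x => ?_, ?_⟩
    · exact (hlogint (P.eval (x : ℂ))).div_const (1 + x ^ 2)
    have hdom : Integrable fun x : ℝ => 4 * Real.pi *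
        (Real.posLog ‖P.eval (x : ℂ)‖ / (1 + x ^ 2) + Real.log 2 * (1 + x ^ 2)⁻¹) :=
      ((integrable_posLog_norm_eval P).add (integrable_inv_one_add_sq.const_mul _)).const_mul _
    refine hdom.mono' hFmeas.norm.integral_prod_right' (ae_of_all _ fun x => ?_)
    rw [Real.norm_of_nonneg (integral_nonneg fun _ => norm_nonneg _)]
    have hx : 0 < 1 + x ^ 2 := by positivity
    set p := P.eval (x : ℂ) with hp
    have hpt : ∀ θ, ‖F x θ‖ ≤ (2 * (Real.posLog ‖p‖ + Real.log 2) -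
        Real.log ‖p + circleMap 0 1 θ‖) / (1 + x ^ 2) := by
      intro θ
      change ‖Real.log ‖p + circleMap 0 1 θ‖ / (1 + x ^ 2)‖ ≤ _
      rw [norm_div, Real.norm_eq_abs, abs_log_eq_two_mul_posLog_sub_log, Real.norm_of_nonneg hx.le]
      have := Real.posLog_norm_add_le p (circleMap 0 1 θ)
      simp only [norm_circleMap_zero, abs_one, Real.posLog_one] at this
      gcongr
      linarith
    have hc := integrable_const (μ := ν) (2 * (Real.posLog ‖p‖ + Real.log 2))
    calc ∫ θ, ‖F x θ‖ ∂ν ≤ ∫ θ, (2 * (Real.posLog ‖p‖ + Real.log 2) -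
          Real.log ‖p + circleMap 0 1 θ‖) / (1 + x ^ 2) ∂ν :=
          integral_mono ((hlogint p).div_const _).norm ((hc.sub (hlogint p)).div_const _) hpt
      _ = (4 * Real.pi * (Real.posLog ‖p‖ + Real.log 2) - 2 * Real.pi * Real.posLog ‖p‖) /
          (1 + x ^ 2) := by
          rw [integral_div, integral_sub hc (hlogint p), hlogval, integral_const, hνvol,
            smul_eq_mul]
          ring
      _ ≤ 4 * Real.pi * (Real.posLog ‖p‖ + Real.log 2) / (1 + x ^ 2) := by
          gcongr
          have := Real.posLog_nonneg (x := ‖p‖)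
          have : 0 ≤ 2 * Real.pi * Real.posLog ‖p‖ := by positivity
          linarith
      _ = _ := by ring
  have hswap := integral_integral_swap hFint
  have hleft : ∫ x, ∫ θ, F x θ ∂ν =
      2 * Real.pi * ∫ x : ℝ, Real.posLog ‖P.eval (x : ℂ)‖ / (1 + x ^ 2) := by
    rw [← integral_const_mul]
    refine integral_congr_ae (ae_of_all _ fun x => ?_)
    simp only [F]
    rw [integral_div, hlogval, mul_div_assoc]
  have hright : ∫ θ, (∫ x, F x θ) ∂ν ≤ 2 * Real.pi * K := by
    calc ∫ θ, (∫ x, F x θ) ∂ν ≤ ∫ _, K ∂ν :=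
          integral_mono hFint.integral_prod_right (integrable_const K) h
      _ = 2 * Real.pi * K := by rw [integral_const, hνvol, smul_eq_mul]
  rw [← hswap, hleft] at hright
  exact le_of_mul_le_mul_left hright (by positivity)

lemma memC0_inv_sub_I {W : ℝ → ℝ} (hWpos : ∀ x, 0 < W x)
    (hWlim : Tendsto (fun x => 1 / W x) (cocompact ℝ) (nhds 0)) :
    MemC0 W fun x : ℝ => ((x : ℂ) - Complex.I)⁻¹ := by
  refine ⟨Continuous.inv₀ (by fun_prop) ofReal_sub_I_ne_zero, ?_⟩
  refine squeeze_zero (fun x => div_nonneg (norm_nonneg _) (hWpos x).le) (fun x => ?_) hWlim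
  have := hWpos x
  gcongr
  exact norm_inv_ofReal_sub_I_le x

lemma memC0_cutoff_mul {W : ℝ → ℝ} (hWc : Continuous W) (A : ℝ) :
    MemC0 W fun x : ℝ => ((max 0 (min 1 (A + 1 - |x|)) * W x : ℝ) : ℂ) := by
  refine ⟨by fun_prop, tendsto_const_nhds.congr' ?_⟩
  rw [← Metric.cobounded_eq_cocompact]
  refine hasBasis_cobounded_norm.eventually_iff.2 ⟨A + 1, trivial, fun x hx => ?_⟩
  have hx' : A + 1 ≤ |x| := hx
  have h0 : max 0 (min 1 (A + 1 - |x|)) = 0 := max_eq_left (min_le_of_right_le (by linarith))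
  simp [h0]

/-- If polynomials are dense, then `log⁺ (W / 2)` has infinite logarithmic integral. -/
lemma PolysDense.not_integrable_posLog {W : ℝ → ℝ} (hWpos : ∀ x, 0 < W x)
    (hWlim : Tendsto (fun x => 1 / W x) (cocompact ℝ) (nhds 0)) (hd : PolysDense W) :
    ¬ Integrable fun x : ℝ => Real.posLog (W x / 2) / (1 + x ^ 2) := by
  intro hlogInt
  have hlin := (hasOuterPart_X_sub_C Complex.I).2.1
  simp only [eval_sub, eval_X, eval_C] at hlin
  have hinv := integrable_inv_one_add_sq
  have hsum : Integrable fun x : ℝ => (Real.log ‖(x : ℂ) - Complex.I‖ / (1 + x ^ 2) +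
      Real.posLog (W x / 2) / (1 + x ^ 2)) + Real.log 2 * (1 + x ^ 2)⁻¹ :=
    (hlin.add hlogInt).add (hinv.const_mul (Real.log 2))
  set J := ∫ x : ℝ, ((Real.log ‖(x : ℂ) - Complex.I‖ / (1 + x ^ 2) +
    Real.posLog (W x / 2) / (1 + x ^ 2)) + Real.log 2 * (1 + x ^ 2)⁻¹) with hJ
  obtain ⟨P, hP⟩ := hd _ (memC0_inv_sub_I hWpos hWlim) (Real.exp (-(|J| + 1))) (Real.exp_pos _)
  set Q : ℂ[X] := 1 - (X - C Complex.I) * P with hQ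
  have hQI : Q.eval Complex.I = 1 := by simp [hQ]
  have hQ0 : Q ≠ 0 := by
    intro h
    simp [h] at hQI
  obtain ⟨-, hQi, Q', -, -, hle, hval⟩ := hasOuterPart hQ0
  have hnonneg : 0 ≤ ∫ x : ℝ, Real.log ‖Q.eval (x : ℂ)‖ / (1 + x ^ 2) := by
    rw [hval]
    rw [hQI, norm_one] at hle
    exact mul_nonneg Real.pi_pos.le (Real.log_nonneg hle)
  have hupper : ∫ x : ℝ, Real.log ‖Q.eval (x : ℂ)‖ / (1 + x ^ 2) ≤
      ∫ x : ℝ, (-(|J| + 1) * (1 + x ^ 2)⁻¹ +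
        ((Real.log ‖(x : ℂ) - Complex.I‖ / (1 + x ^ 2) +
          Real.posLog (W x / 2) / (1 + x ^ 2)) + Real.log 2 * (1 + x ^ 2)⁻¹)) := by
    refine integral_mono_ae hQi ((hinv.const_mul _).add hsum) ?_
    filter_upwards [ae_eval_ofReal_ne_zero hQ0] with x hx
    have hxI := ofReal_sub_I_ne_zero x
    have hW := hWpos x
    have hQx : Q.eval (x : ℂ) =
        ((x : ℂ) - Complex.I) * (((x : ℂ) - Complex.I)⁻¹ - P.eval (x : ℂ)) := by
      rw [mul_sub, mul_inv_cancel₀ hxI]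
      simp [hQ]
    have hbd : ‖Q.eval (x : ℂ)‖ ≤
        ‖(x : ℂ) - Complex.I‖ * (Real.exp (-(|J| + 1)) * (W x / 2 * 2)) := by
      rw [hQx, norm_mul, div_mul_cancel₀ _ two_ne_zero]
      exact mul_le_mul_of_nonneg_left (hP x) (norm_nonneg _)
    have hlog := Real.log_le_log (norm_pos_iff.2 hx) hbd
    rw [Real.log_mul (norm_ne_zero_iff.2 hxI) (by positivity),
      Real.log_mul (by positivity) (by positivity), Real.log_exp,
      Real.log_mul (by positivity) two_ne_zero] at hlog
    have hpos : Real.log (W x / 2) ≤ Real.posLog (W x / 2) := le_max_right _ _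
    calc Real.log ‖Q.eval (x : ℂ)‖ / (1 + x ^ 2)
        ≤ (Real.log ‖(x : ℂ) - Complex.I‖ + (-(|J| + 1) +
            (Real.posLog (W x / 2) + Real.log 2))) / (1 + x ^ 2) := by
          gcongr
          linarith
      _ = _ := by ring
  rw [integral_add (hinv.const_mul _) hsum, integral_const_mul, integral_univ_inv_one_add_sq,
    ← hJ] at hupper
  nlinarith [le_abs_self J, abs_nonneg J, Real.pi_gt_three]

/-- If the logarithmic integrals of the polynomials bounded by `W` are bounded above, then so are
those of `log⁺` of any polynomial bounded by a multiple of `W`. -/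
lemma integral_posLog_norm_eval_le_of_forall_lt {W : ℝ → ℝ} {K L : ℝ} (hL : 0 < L)
    (h : ∀ P : ℂ[X], (∀ x : ℝ, ‖P.eval (x : ℂ)‖ ≤ W x) →
      ∫ x : ℝ, Real.log ‖P.eval (x : ℂ)‖ / (1 + x ^ 2) < K)
    {P : ℂ[X]} (hP : ∀ x : ℝ, ‖P.eval (x : ℂ)‖ + 1 ≤ L * W x) :
    ∫ x : ℝ, Real.posLog ‖P.eval (x : ℂ)‖ / (1 + x ^ 2) ≤ max 0 (K + Real.pi * Real.log L) := by
  refine integral_posLog_norm_eval_le fun θ => ?_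
  set R : ℂ[X] := P + C (circleMap 0 1 θ) with hR
  have hReval : ∀ x : ℝ, R.eval (x : ℂ) = P.eval (x : ℂ) + circleMap 0 1 θ := fun x => by
    simp [hR]
  simp only [← hReval]
  rcases eq_or_ne R 0 with h0 | h0
  · simp [h0]
  refine le_max_of_le_right ?_
  have hinv := integrable_inv_one_add_sq
  have hRi := (hasOuterPart h0).2.1
  have hlt := h (C ((L⁻¹ : ℝ) : ℂ) * R) fun x => by
    rw [eval_mul, eval_C, norm_mul, Complex.norm_real, Real.norm_of_nonneg (by positivity),
      inv_mul_le_iff₀ hL, hReval]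
    refine (norm_add_le _ _).trans ?_
    simpa using hP x
  have hae : (fun x : ℝ => Real.log ‖(C ((L⁻¹ : ℝ) : ℂ) * R).eval (x : ℂ)‖ / (1 + x ^ 2))
      =ᵐ[volume] fun x : ℝ => Real.log ‖R.eval (x : ℂ)‖ / (1 + x ^ 2) -
        Real.log L * (1 + x ^ 2)⁻¹ := by
    filter_upwards [ae_eval_ofReal_ne_zero h0] with x hx
    rw [eval_mul, eval_C, norm_mul, Complex.norm_real, Real.norm_of_nonneg (by positivity),
      Real.log_mul (by positivity) (norm_ne_zero_iff.2 hx), Real.log_inv]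
    ring
  rw [integral_congr_ae hae, integral_sub hRi (hinv.const_mul _), integral_const_mul,
    integral_univ_inv_one_add_sq] at hlt
  linarith

lemma PolysDense.exists_le_integral_log {W : ℝ → ℝ} (hWc : Continuous W) (hWpos : ∀ x, 0 < W x)
    (hWlim : Tendsto (fun x => 1 / W x) (cocompact ℝ) (nhds 0))
    (hWlow : ∃ K : ℝ, 0 < K ∧ ∀ x, 1 ≤ K * W x) (hd : PolysDense W) (K : ℝ) :
    ∃ P : ℂ[X], (∀ x : ℝ, ‖P.eval (x : ℂ)‖ ≤ W x) ∧
      K ≤ ∫ x : ℝ, Real.log ‖P.eval (x : ℂ)‖ / (1 + x ^ 2) := by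
  by_contra! hcon
  obtain ⟨c, hc0, hc⟩ := hWlow
  have hcont : Continuous fun x : ℝ => Real.posLog (W x / 2) / (1 + x ^ 2) :=
    (Real.continuous_posLog.comp (hWc.div_const 2)).div (by fun_prop) fun x => by positivity
  refine hd.not_integrable_posLog hWpos hWlim ?_
  have hcover : AECover volume atTop fun n : ℕ => Set.Icc (-(n : ℝ)) n :=
    aecover_Icc (tendsto_neg_atTop_atBot.comp tendsto_natCast_atTop_atTop)
      tendsto_natCast_atTop_atTop
  refine hcover.integrable_of_integral_norm_bounded
    (max 0 (K + Real.pi * Real.log (3 / 2 + c)))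
    (fun n => hcont.continuousOn.integrableOn_Icc) (Eventually.of_forall fun n => ?_)
  obtain ⟨P, hP⟩ := hd _ (memC0_cutoff_mul hWc n) (1 / 2) one_half_pos
  have hpt : ∀ x : ℝ, ‖P.eval (x : ℂ)‖ + 1 ≤ (3 / 2 + c) * W x := by
    intro x
    have hW := hWpos x
    set t : ℝ := max 0 (min 1 (n + 1 - |x|)) with ht
    have ht0 : 0 ≤ t := le_max_left _ _
    have ht1 : t ≤ 1 := max_le zero_le_one (min_le_left _ _)
    have h1 := norm_sub_norm_le (P.eval (x : ℂ)) ((t * W x : ℝ) : ℂ)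
    rw [norm_sub_rev, Complex.norm_real, Real.norm_of_nonneg (by positivity)] at h1
    have h2 := hP x
    have h3 := hc x
    nlinarith
  have hnn : ∀ x : ℝ, 0 ≤ Real.posLog ‖P.eval (x : ℂ)‖ / (1 + x ^ 2) := fun x =>
    div_nonneg Real.posLog_nonneg (by positivity)
  have hPi := integrable_posLog_norm_eval P
  calc ∫ x in Set.Icc (-(n : ℝ)) n, ‖Real.posLog (W x / 2) / (1 + x ^ 2)‖
      ≤ ∫ x in Set.Icc (-(n : ℝ)) n, Real.posLog ‖P.eval (x : ℂ)‖ / (1 + x ^ 2) := by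
        refine setIntegral_mono_on hcont.norm.continuousOn.integrableOn_Icc hPi.integrableOn
          measurableSet_Icc fun x hx => ?_
        rw [Real.norm_of_nonneg (div_nonneg Real.posLog_nonneg (by positivity))]
        have hW := hWpos x
        gcongr
        have hx' : |x| ≤ n := abs_le.2 hx
        have h2 := hP x
        rw [min_eq_left (by linarith), max_eq_right zero_le_one, one_mul] at h2
        have h1 := norm_sub_norm_le ((W x : ℝ) : ℂ) (P.eval (x : ℂ))
        rw [Complex.norm_real, Real.norm_of_nonneg hW.le] at h1
        linarith
    _ ≤ ∫ x : ℝ, Real.posLog ‖P.eval (x : ℂ)‖ / (1 + x ^ 2) :=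
        setIntegral_le_integral hPi (ae_of_all _ hnn)
    _ ≤ _ := integral_posLog_norm_eval_le_of_forall_lt (by positivity) hcon hpt

/-- Pollard's criterion: the polynomials are dense in `C₀(W)` if and only if
`sup { ∫_ℝ log|P(x)|/(1+x²) dx : ‖P‖_{C₀(W)} ≤ 1 } = ∞`, i.e. the set of these
integrals is unbounded above.  (Since `W > 0` is real-valued, `‖P‖_{C₀(W)} ≤ 1`
is equivalent to `∀ x, |P(x)| ≤ W(x)`.) -/
theorem stmt2 (W : ℝ → ℝ) (hWc : Continuous W) (hWpos : ∀ x, 0 < W x)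
    (hWgrow : ∀ n : ℕ, Tendsto (fun x : ℝ => x ^ n / W x) (cocompact ℝ) (nhds 0)) :
    PolysDense W ↔
      ∀ C : ℝ, ∃ P : Polynomial ℂ, (∀ x : ℝ, ‖P.eval (x : ℂ)‖ ≤ W x) ∧
        C ≤ ∫ x : ℝ, Real.log ‖P.eval (x : ℂ)‖ / (1 + x ^ 2) := by
  have hW := exists_pow_le_mul_weight hWc hWpos hWgrow
  refine ⟨fun hd => hd.exists_le_integral_log hWc hWpos (by simpa using hWgrow 0)
    (by simpa using hW 0), fun h => ?_⟩
  exact polysDense_of_isPolynomialLimit hWpos hW (isPolynomialLimit_inv_sub_I h)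
end
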